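/- The matching complex of the cycle C_n (n ≥ 3) is homotopy equivalent to a wedge of two spheres S^{k-1} if n = 3k, and to a single sphere S^{k-1} if n = 3k±1. -/

import Mathlib

noncomputable section

/-- The geometric realization of a set of faces `K` (an abstract simplicial complex):
the space of convex-combination weight functions supported on a face. -/
def realization {α : Type*} (K : Set (Finset α)) : Type _ :=
  {f : α → ℝ // (∀ a, 0 ≤ f a) ∧ ∃ s ∈ K, Function.support f ⊆ ↑s ∧ ∑ a ∈ s, f a = 1}

instance realization.topologicalSpace {α : Type*} (K : Set (Finset α)) :
    TopologicalSpace (realization K) :=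
  instTopologicalSpaceSubtype

/-- The unreduced suspension of a space: the cylinder `X × [0,1]` together with two cone
points, gluing `X × {0}` to one and `X × {1}` to the other.  (With this definition, the
suspension of the empty space is the two-point space `S⁰`.) -/
def Susp (X : Type*) [TopologicalSpace X] : Type _ :=
  Quot (fun (p q : (X × Set.Icc (0:ℝ) 1) ⊕ Bool) =>
    match p, q with
    | Sum.inl p, Sum.inr b => ((p.2 : ℝ) = 0 ∧ b = false) ∨ ((p.2 : ℝ) = 1 ∧ b = true)
    | _, _ => False)

instance Susp.topologicalSpace (X : Type*) [TopologicalSpace X] :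
    TopologicalSpace (Susp X) := by
  unfold Susp; infer_instance

/-- The wedge sum of two pointed spaces. -/
def Wedge (X : Type*) (Y : Type*) [TopologicalSpace X] [TopologicalSpace Y]
    (x : X) (y : Y) : Type _ :=
  Quot (fun (a b : X ⊕ Y) => a = Sum.inl x ∧ b = Sum.inr y)

instance Wedge.topologicalSpace (X : Type*) (Y : Type*) [TopologicalSpace X]
    [TopologicalSpace Y] (x : X) (y : Y) : TopologicalSpace (Wedge X Y x y) := by
  unfold Wedge; infer_instance

/-- The `n`-sphere, as the unit sphere in `ℝ^(n+1)`. -/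
def nSphere (n : ℕ) : Type :=
  Metric.sphere (0 : EuclideanSpace ℝ (Fin (n + 1))) 1

instance nSphere.topologicalSpace (n : ℕ) : TopologicalSpace (nSphere n) := by
  unfold nSphere; infer_instance

/-- A basepoint on the `n`-sphere. -/
def spherePt (n : ℕ) : nSphere n :=
  ⟨EuclideanSpace.single 0 1, by simp [EuclideanSpace.norm_single]⟩

/-- The wedge of a family of spheres, of dimensions `n i`. -/
def WedgeOfSpheres {ι : Type} (n : ι → ℕ) : Type :=
  Quot (fun (a b : Σ i, nSphere (n i)) =>
    ∃ i j, a = ⟨i, spherePt (n i)⟩ ∧ b = ⟨j, spherePt (n j)⟩)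

instance WedgeOfSpheres.topologicalSpace {ι : Type} (n : ι → ℕ) :
    TopologicalSpace (WedgeOfSpheres n) := by
  unfold WedgeOfSpheres; infer_instance

/-- A space is (homotopy equivalent to) a wedge of spheres if it is homotopy equivalent to a
wedge of finitely many spheres of possibly varying dimensions. -/
def IsWedgeOfSpheres (X : Type*) [TopologicalSpace X] : Prop :=
  ∃ (k : ℕ) (n : Fin k → ℕ), Nonempty (ContinuousMap.HomotopyEquiv X (WedgeOfSpheres n))
/-- The matching complex of a simple graph: faces are finite sets of pairwise disjoint edges. -/
def matchingComplex {V : Type*} (G : SimpleGraph V) : Set (Finset (Sym2 V)) :=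
  {s | (∀ e ∈ s, e ∈ G.edgeSet) ∧ ∀ e ∈ s, ∀ f ∈ s, e ≠ f → ∀ v, v ∈ e → v ∉ f}

/-- The open edge neighborhood `EN(e)`: the set of edges of `G` adjacent to (sharing a vertex
with) `e`, other than `e` itself. -/
def edgeNbhdOpen {V : Type*} (G : SimpleGraph V) (e : Sym2 V) : Set (Sym2 V) :=
  {f | f ∈ G.edgeSet ∧ f ≠ e ∧ ∃ v, v ∈ e ∧ v ∈ f}

/-- The closed edge neighborhood `EN[e]`: the set of edges of `G` sharing a vertex with `e`,
together with `e` itself. -/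
def edgeNbhdClosed {V : Type*} (G : SimpleGraph V) (e : Sym2 V) : Set (Sym2 V) :=
  {f | f ∈ G.edgeSet ∧ ∃ v, v ∈ e ∧ v ∈ f}

/-- Two chords of a circle, with endpoints at circle positions `a, b` and `c, d`
(positions measured injectively along the circle), cross iff their endpoints interleave. -/
def chordsCross (a b c d : ℝ) : Prop :=
  (min a b < min c d ∧ min c d < max a b ∧ max a b < max c d) ∨
  (min c d < min a b ∧ min a b < max c d ∧ max c d < max a b)

/-- A graph is outerplanar iff it has a drawing with all vertices (injectively) on a circle
and edges drawn as pairwise noncrossing chords; equivalently, a planar drawing with every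
vertex on the unbounded face. -/
def Outerplanar {V : Type*} (G : SimpleGraph V) : Prop :=
  ∃ f : V ↪ ℝ, ∀ a b c d, G.Adj a b → G.Adj c d →
    a ≠ c → a ≠ d → b ≠ c → b ≠ d → ¬ chordsCross (f a) (f b) (f c) (f d)

/-- An outerplanar graph is maximal outerplanar if adding any edge destroys outerplanarity. -/
def MaximalOuterplanar {V : Type*} (G : SimpleGraph V) : Prop :=
  Outerplanar G ∧ ∀ a b : V, a ≠ b → ¬ G.Adj a b →
    ¬ Outerplanar (G ⊔ SimpleGraph.fromEdgeSet {s(a, b)})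
/-- A cutpoint (cut-vertex) of a graph: a vertex whose removal disconnects two vertices that
were connected, i.e. whose removal increases the number of connected components. -/
def IsCutvertex {V : Type*} (G : SimpleGraph V) (v : V) : Prop :=
  ∃ a b : {u : V // u ≠ v}, G.Reachable a.1 b.1 ∧
    ¬ (G.induce {u : V | u ≠ v}).Reachable ⟨a.1, a.2⟩ ⟨b.1, b.2⟩

/-- A block of `G`: a maximal connected subgraph having no cutpoint of itself. -/
def IsBlock {V : Type*} (G : SimpleGraph V) (H : G.Subgraph) : Prop :=
  H.Connected ∧ (∀ v, ¬ IsCutvertex H.coe v) ∧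
    ∀ H' : G.Subgraph, H ≤ H' → H'.Connected → (∀ v, ¬ IsCutvertex H'.coe v) → H' = H

/-- The block-cutpoint graph of `G`: the bipartite graph on blocks and cutpoints of `G`,
with a block `B` adjacent to a cutpoint `c` iff `c` belongs to `B`. -/
def blockCutpointGraph {V : Type*} (G : SimpleGraph V) :
    SimpleGraph ({H : G.Subgraph // IsBlock G H} ⊕ {v : V // IsCutvertex G v}) :=
  SimpleGraph.fromRel (fun x y =>
    ∃ B c, x = Sum.inl B ∧ y = Sum.inr c ∧ c.1 ∈ B.1.verts)

/-- A cycle (given as a closed walk) is chordless if every edge of `G` joining two of its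
vertices is an edge of the cycle.  In an outerplanar graph drawn with all vertices on the
unbounded face, the basic cycles (boundaries of the bounded faces) are exactly the
chordless cycles. -/
def Chordless {V : Type*} (G : SimpleGraph V) {v : V} (p : G.Walk v v) : Prop :=
  ∀ a ∈ p.support, ∀ b ∈ p.support, G.Adj a b → s(a, b) ∈ p.edges

/-- The basic cycles of (an outerplanar graph) `G`, recorded by their edge sets. -/
def basicCycles {V : Type*} [DecidableEq V] (G : SimpleGraph V) : Set (Finset (Sym2 V)) :=
  {s | ∃ (v : V) (p : G.Walk v v), p.IsCycle ∧ Chordless G p ∧ s = p.edges.toFinset}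

/-- The weak dual of (an outerplanar graph) `G`: vertices are the basic cycles (bounded
faces), two being adjacent iff they share at least one edge. -/
def weakDual {V : Type*} [DecidableEq V] (G : SimpleGraph V) :
    SimpleGraph (basicCycles G) :=
  SimpleGraph.fromRel (fun s t => ((s.1 ∩ t.1) : Finset (Sym2 V)).Nonempty)

/-- A multigraph on vertex set `V`: an edge index type together with an assignment of
(unordered pairs of) endpoints. -/
structure Multigraph (V : Type u) : Type (max u (v + 1)) where
  E : Type v
  ends : E → Sym2 V

/-- The matching complex of a multigraph: faces are finite sets of pairwise
vertex-disjoint edges. -/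
def Multigraph.matchingComplex {V : Type*} (M : Multigraph V) : Set (Finset M.E) :=
  {s | ∀ i ∈ s, ∀ j ∈ s, i ≠ j → ∀ v, v ∈ M.ends i → v ∉ M.ends j}

namespace MC

theorem mem_iff {α : Type*} [Fintype α] {K : Set (Finset α)} {f : α → ℝ} :
    ((∀ a, 0 ≤ f a) ∧ ∃ s ∈ K, Function.support f ⊆ ↑s ∧ ∑ a ∈ s, f a = 1) ↔
    ((∀ a, 0 ≤ f a) ∧ (∑ a, f a = 1) ∧ ∃ s ∈ K, Function.support f ⊆ ↑s) := by
  have key : ∀ s : Finset α, Function.support f ⊆ ↑s → ∑ a ∈ s, f a = ∑ a, f a := by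
    intro s hs
    apply Finset.sum_subset (Finset.subset_univ _)
    intro a _ ha
    by_contra h
    exact ha (by simpa using hs h)
  constructor
  · rintro ⟨h0, s, hs, h1, h2⟩
    exact ⟨h0, (key s h1) ▸ h2, s, hs, h1⟩
  · rintro ⟨h0, h2, s, hs, h1⟩
    exact ⟨h0, s, hs, h1, (key s h1).trans h2⟩

/-- Points of the realization. -/
def mk {α : Type*} [Fintype α] {K : Set (Finset α)} (f : α → ℝ) (h0 : ∀ a, 0 ≤ f a)
    (h1 : ∑ a, f a = 1) (h2 : ∃ s ∈ K, Function.support f ⊆ ↑s) : realization K :=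
  ⟨f, mem_iff.2 ⟨h0, h1, h2⟩⟩

/-- The down-closed condition. -/
def Down {α : Type*} (K : Set (Finset α)) : Prop := ∀ s ∈ K, ∀ t ⊆ s, t ∈ K

/-- Relabelling the vertices. -/
theorem relabel {α β : Type*} [Fintype α] [Fintype β] (e : β ↪ α) (K : Set (Finset α))
    (L : Set (Finset β)) (h : ∀ s, s ∈ K ↔ ∃ t ∈ L, s = t.map e) :
    Nonempty (ContinuousMap.HomotopyEquiv (realization K) (realization L)) := by
  classical
  refine ⟨Homeomorph.toHomotopyEquiv
    { toFun := fun f => ⟨fun b => f.1 (e b), fun b => f.2.1 _, ?_⟩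
      invFun := fun g => ⟨Function.extend e g.1 0, ?_, ?_⟩
      left_inv := ?_
      right_inv := ?_
      continuous_toFun := ?_
      continuous_invFun := ?_ }⟩
  · obtain ⟨h0, s, hs, h1, h2⟩ := f.2
    obtain ⟨t, ht, rfl⟩ := (h s).1 hs
    refine ⟨t, ht, ?_, ?_⟩
    · intro b hb
      have := h1 hb
      simpa using this
    · rw [Finset.sum_map] at h2
      exact h2
  · intro a
    by_cases ha : ∃ b, e b = a
    · obtain ⟨b, rfl⟩ := ha
      rw [e.injective.extend_apply]
      exact g.2.1 b
    · rw [Function.extend_apply' _ _ _ ha]; simp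
  · obtain ⟨h0, t, ht, h1, h2⟩ := g.2
    refine ⟨t.map e, (h _).2 ⟨t, ht, rfl⟩, ?_, ?_⟩
    · intro a ha
      by_cases hab : ∃ b, e b = a
      · obtain ⟨b, rfl⟩ := hab
        rw [Function.mem_support, e.injective.extend_apply] at ha
        simpa using h1 ha
      · rw [Function.mem_support, Function.extend_apply' _ _ _ hab] at ha
        simp at ha
    · rw [Finset.sum_map]
      simp only [e.injective.extend_apply]
      exact h2
  · intro f
    apply Subtype.ext
    funext a
    by_cases hab : ∃ b, e b = a
    · obtain ⟨b, rfl⟩ := hab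
      simp [e.injective.extend_apply]
    · simp only
      rw [Function.extend_apply' _ _ _ hab]
      obtain ⟨h0, s, hs, h1, h2⟩ := f.2
      obtain ⟨t, ht, rfl⟩ := (h s).1 hs
      by_contra hne
      have := h1 (show a ∈ Function.support f.1 from fun hh => hne (by simp [hh]))
      simp only [Finset.coe_map, Set.mem_image] at this
      obtain ⟨b, _, hb⟩ := this
      exact hab ⟨b, hb⟩
  · intro g
    apply Subtype.ext
    funext b
    simp [e.injective.extend_apply]
  · refine Continuous.subtype_mk ?_ _
    exact continuous_pi fun b => (continuous_apply (e b)).comp continuous_subtype_val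
  · refine Continuous.subtype_mk ?_ _
    refine continuous_pi fun a => ?_
    by_cases hab : ∃ b, e b = a
    · obtain ⟨b, rfl⟩ := hab
      simp only [e.injective.extend_apply]
      exact (continuous_apply b).comp continuous_subtype_val
    · simp only [Function.extend_apply' _ _ _ hab]
      exact continuous_const

/-- The formula for the collapse. -/
def cform {α : Type*} [DecidableEq α] (τ : Finset α) (hτ : τ.Nonempty) (w : α) (u : ℝ)
    (f : α → ℝ) : α → ℝ := fun a =>
  f a - u * τ.inf' hτ f * (if a ∈ τ then 1 else 0) +
    u * τ.inf' hτ f * (τ.card : ℝ) * (if a = w then 1 else 0)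

theorem cform_mem {α : Type*} [Fintype α] [DecidableEq α] {K : Set (Finset α)} {τ : Finset α}
    (hτ : τ.Nonempty) {w : α} (hw : w ∉ τ) (hK : ∀ σ ∈ K, τ ⊆ σ → insert w σ ∈ K)
    {u : ℝ} (hu0 : 0 ≤ u) (hu1 : u ≤ 1) (f : realization K) :
    (∀ a, 0 ≤ cform τ hτ w u f.1 a) ∧ (∑ a, cform τ hτ w u f.1 a = 1) ∧
      ∃ s ∈ K, Function.support (cform τ hτ w u f.1) ⊆ ↑s := by
  obtain ⟨h0, h1, s, hs, h2⟩ := mem_iff.1 f.2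
  have hm0 : 0 ≤ τ.inf' hτ f.1 := by
    rw [Finset.le_inf'_iff]; exact fun a _ => h0 a
  have hum : u * τ.inf' hτ f.1 ≤ τ.inf' hτ f.1 := mul_le_of_le_one_left hm0 hu1
  have hum0 : 0 ≤ u * τ.inf' hτ f.1 := mul_nonneg hu0 hm0
  refine ⟨?_, ?_, ?_⟩
  · intro a
    unfold cform
    have h3 : 0 ≤ u * τ.inf' hτ f.1 * (τ.card : ℝ) * (if a = w then 1 else 0) := by
      split_ifs <;> positivity
    by_cases ha : a ∈ τ
    · have := Finset.inf'_le f.1 ha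
      simp only [ha, if_true]
      linarith
    · simp only [ha, if_false]
      linarith [h0 a]
  · unfold cform
    rw [Finset.sum_add_distrib, Finset.sum_sub_distrib, ← Finset.mul_sum, ← Finset.mul_sum, h1]
    simp
  · by_cases hts : τ ⊆ s
    · refine ⟨insert w s, hK s hs hts, ?_⟩
      intro a ha
      by_contra hna
      simp only [Finset.coe_insert, Set.mem_insert_iff, not_or, Finset.mem_coe] at hna
      apply ha
      have h4 : f.1 a = 0 := by
        by_contra h; exact hna.2 (by simpa using h2 h)
      have h5 : a ∉ τ := fun h => hna.2 (hts h)
      simp [cform, h4, h5, hna.1]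
    · refine ⟨s, hs, ?_⟩
      obtain ⟨b, hb, hbs⟩ := Finset.not_subset.1 hts
      have hfb : f.1 b = 0 := by
        by_contra h; exact hbs (by simpa using h2 h)
      have hm : τ.inf' hτ f.1 = 0 := le_antisymm ((Finset.inf'_le f.1 hb).trans_eq hfb) hm0
      have : cform τ hτ w u f.1 = f.1 := by
        funext a; simp [cform, hm]
      rw [this]; exact h2

theorem cform_mem' {α : Type*} [Fintype α] [DecidableEq α] {K : Set (Finset α)} {τ : Finset α}
    (hd : Down K)
    (hτ : τ.Nonempty) {w : α} (hw : w ∉ τ) (hK : ∀ σ ∈ K, τ ⊆ σ → insert w σ ∈ K)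
    (f : realization K) :
    ∃ s ∈ {s ∈ K | ¬ τ ⊆ s}, Function.support (cform τ hτ w 1 f.1) ⊆ ↑s := by
  obtain ⟨-, -, s, hs, h2⟩ := cform_mem hτ hw hK zero_le_one le_rfl f
  obtain ⟨b, hb, hbm⟩ := Finset.exists_mem_eq_inf' hτ f.1
  have hbw : b ≠ w := fun h => hw (h ▸ hb)
  refine ⟨s.erase b, ⟨hd s hs _ (Finset.erase_subset _ _), ?_⟩, ?_⟩
  · intro h
    exact (Finset.notMem_erase b s) (h hb)
  · intro a ha
    have has := h2 ha
    simp only [Finset.coe_erase, Set.mem_sdiff, Set.mem_singleton_iff]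
    refine ⟨has, ?_⟩
    rintro rfl
    apply ha
    simp [cform, hb, hbw, hbm]

theorem cform_cont {α Z : Type*} [DecidableEq α] [TopologicalSpace Z] (τ : Finset α)
    (hτ : τ.Nonempty) (w : α) (u : Z → ℝ) (hu : Continuous u) (f : Z → α → ℝ) (hf : Continuous f) :
    Continuous fun z => cform τ hτ w (u z) (f z) := by
  have hm : Continuous fun z => τ.inf' hτ (f z) :=
    Continuous.finset_inf'_apply hτ fun i _ => (continuous_apply i).comp hf
  refine continuous_pi fun a => ?_
  unfold cform
  have := (continuous_apply a).comp hf
  simp only [Function.comp_def] at this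
  fun_prop

theorem collapse {α : Type*} [Fintype α] [DecidableEq α] {K : Set (Finset α)} (τ : Finset α)
    (hd : Down K)
    (hτ : τ.Nonempty) (w : α) (hw : w ∉ τ) (hK : ∀ σ ∈ K, τ ⊆ σ → insert w σ ∈ K) :
    Nonempty (ContinuousMap.HomotopyEquiv (realization K) (realization {s ∈ K | ¬ τ ⊆ s})) := by
  let r : C(realization K, realization {s ∈ K | ¬ τ ⊆ s}) :=
    ⟨fun f => mk (cform τ hτ w 1 f.1) (cform_mem hτ hw hK zero_le_one le_rfl f).1
      (cform_mem hτ hw hK zero_le_one le_rfl f).2.1 (cform_mem' hd hτ hw hK f),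
      Continuous.subtype_mk (cform_cont τ hτ w _ continuous_const _ continuous_subtype_val) _⟩
  let i : C(realization {s ∈ K | ¬ τ ⊆ s}, realization K) :=
    ⟨fun f => ⟨f.1, f.2.1, f.2.2.imp fun s hs => ⟨hs.1.1, hs.2⟩⟩,
      Continuous.subtype_mk continuous_subtype_val _⟩
  refine ⟨⟨r, i, ?_, ?_⟩⟩
  · refine ContinuousMap.Homotopic.symm ⟨⟨⟨fun p => mk (cform τ hτ w p.1 p.2.1)
      (cform_mem hτ hw hK p.1.2.1 p.1.2.2 p.2).1 (cform_mem hτ hw hK p.1.2.1 p.1.2.2 p.2).2.1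
      (cform_mem hτ hw hK p.1.2.1 p.1.2.2 p.2).2.2, ?_⟩, ?_, ?_⟩⟩
    · exact Continuous.subtype_mk (cform_cont τ hτ w _ (by fun_prop) _
        (continuous_subtype_val.comp continuous_snd)) _
    · intro f
      apply Subtype.ext
      funext a
      simp [mk, cform]
    · intro f
      rfl
  · have : r.comp i = ContinuousMap.id _ := by
      ext f
      apply Subtype.ext
      obtain ⟨h0, h1, s, hs, h2⟩ := mem_iff.1 f.2
      obtain ⟨b, hb, hbs⟩ := Finset.not_subset.1 hs.2
      have hfb : f.1 b = 0 := by
        by_contra h; exact hbs (by simpa using h2 h)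
      have hm : τ.inf' hτ f.1 = 0 := le_antisymm ((Finset.inf'_le f.1 hb).trans_eq hfb) (by
        rw [Finset.le_inf'_iff]; exact fun a _ => h0 a)
      funext a
      change cform τ hτ w 1 f.1 a = f.1 a
      simp [cform, hm]
    rw [this]

/-- Replace an edge `ab` by a path `a x y z b`. -/
theorem step {α : Type*} [Fintype α] [DecidableEq α] {B : Set (Finset α)} (hd : Down B)
    (a b x y z : α) (hax : a ≠ x) (hay : a ≠ y) (haz : a ≠ z) (hbx : b ≠ x) (hby : b ≠ y)
    (hbz : b ≠ z) (hxy : x ≠ y) (hxz : x ≠ z) (hyz : y ≠ z)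
    (hx : ∀ s ∈ B, insert x s ∈ B) (hy : ∀ s ∈ B, insert y s ∈ B) (hz : ∀ s ∈ B, insert z s ∈ B) :
    Nonempty (ContinuousMap.HomotopyEquiv
      (realization {s ∈ B | ¬ (a ∈ s ∧ x ∈ s) ∧ ¬ (x ∈ s ∧ y ∈ s) ∧ ¬ (y ∈ s ∧ z ∈ s) ∧
        ¬ (z ∈ s ∧ b ∈ s)})
      (realization {s ∈ B | ¬ (a ∈ s ∧ b ∈ s) ∧ ¬ (x ∈ s ∧ y ∈ s) ∧ z ∉ s})) := by
  obtain ⟨e1⟩ := collapse (K := {s ∈ B | ¬ (a ∈ s ∧ x ∈ s) ∧ ¬ (x ∈ s ∧ y ∈ s) ∧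
      ¬ (y ∈ s ∧ z ∈ s) ∧ ¬ (z ∈ s ∧ b ∈ s)}) {a, b} (by
        rintro s ⟨h0, h⟩ t ht
        exact ⟨hd s h0 t ht, by grind⟩) (by simp) y (by grind) (by
        rintro s ⟨h0, h⟩ ht
        exact ⟨hy s h0, by grind⟩)
  obtain ⟨e2⟩ := collapse (K := {s ∈ B | ¬ (a ∈ s ∧ b ∈ s) ∧ ¬ (x ∈ s ∧ y ∈ s) ∧
      ¬ (y ∈ s ∧ z ∈ s) ∧ ¬ (z ∈ s ∧ b ∈ s)}) {a, x} (by
        rintro s ⟨h0, h⟩ t ht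
        exact ⟨hd s h0 t ht, by grind⟩) (by simp) z (by grind) (by
        rintro s ⟨h0, h⟩ ht
        exact ⟨hz s h0, by grind⟩)
  obtain ⟨e3⟩ := collapse (K := {s ∈ B | ¬ (a ∈ s ∧ b ∈ s) ∧ ¬ (x ∈ s ∧ y ∈ s) ∧
      ¬ (y ∈ s ∧ z ∈ s) ∧ ¬ (z ∈ s ∧ b ∈ s)}) {z} (by
        rintro s ⟨h0, h⟩ t ht
        exact ⟨hd s h0 t ht, by grind⟩) (by simp) x (by grind) (by
        rintro s ⟨h0, h⟩ ht
        exact ⟨hx s h0, by grind⟩)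
  have h12 : {s ∈ {s ∈ B | ¬ (a ∈ s ∧ x ∈ s) ∧ ¬ (x ∈ s ∧ y ∈ s) ∧
      ¬ (y ∈ s ∧ z ∈ s) ∧ ¬ (z ∈ s ∧ b ∈ s)} | ¬ {a, b} ⊆ s} =
      {s ∈ {s ∈ B | ¬ (a ∈ s ∧ b ∈ s) ∧ ¬ (x ∈ s ∧ y ∈ s) ∧
      ¬ (y ∈ s ∧ z ∈ s) ∧ ¬ (z ∈ s ∧ b ∈ s)} | ¬ {a, x} ⊆ s} := by
    ext s
    simp only [Set.mem_ofPred_eq, Finset.insert_subset_iff, Finset.singleton_subset_iff]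
    tauto
  have h3 : {s ∈ {s ∈ B | ¬ (a ∈ s ∧ b ∈ s) ∧ ¬ (x ∈ s ∧ y ∈ s) ∧
      ¬ (y ∈ s ∧ z ∈ s) ∧ ¬ (z ∈ s ∧ b ∈ s)} | ¬ {z} ⊆ s} =
      {s ∈ B | ¬ (a ∈ s ∧ b ∈ s) ∧ ¬ (x ∈ s ∧ y ∈ s) ∧ z ∉ s} := by
    ext s
    simp only [Set.mem_ofPred_eq, Finset.singleton_subset_iff]
    tauto
  rw [h12] at e1
  rw [h3] at e3
  exact ⟨(e1.trans e2.symm).trans e3⟩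

/-- The family of complexes interpolating between `Ind(C_n)` and the final one. -/
def Kc (n c : ℕ) : Set (Finset (Fin n)) :=
  {s | (∀ i ∈ s, ∀ j ∈ s, (i : ℕ) + 1 = j → (j : ℕ) < c → False) ∧
       (∀ i ∈ s, ∀ j ∈ s, (i : ℕ) = 0 → (j : ℕ) + 1 = c → False) ∧
       (∀ i ∈ s, c ≤ (i : ℕ) → ((i : ℕ) - c) % 3 = 2 → False) ∧
       (∀ i ∈ s, ∀ j ∈ s, c ≤ (i : ℕ) → (i : ℕ) + 1 = j → ((i : ℕ) - c) % 3 = 0 → False)}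

theorem Kc_step (n c : ℕ) (hc : 1 ≤ c) (hn : c + 3 ≤ n) :
    Nonempty (ContinuousMap.HomotopyEquiv (realization (Kc n (c + 3))) (realization (Kc n c))) := by
  let a : Fin n := ⟨c - 1, by omega⟩
  let b : Fin n := ⟨0, by omega⟩
  let x : Fin n := ⟨c, by omega⟩
  let y : Fin n := ⟨c + 1, by omega⟩
  let z : Fin n := ⟨c + 2, by omega⟩
  let B : Set (Finset (Fin n)) :=
    {s | (∀ i ∈ s, ∀ j ∈ s, (i : ℕ) + 1 = j → (j : ℕ) < c → False) ∧
       (∀ i ∈ s, c + 3 ≤ (i : ℕ) → ((i : ℕ) - c) % 3 = 2 → False) ∧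
       (∀ i ∈ s, ∀ j ∈ s, c + 3 ≤ (i : ℕ) → (i : ℕ) + 1 = j → ((i : ℕ) - c) % 3 = 0 → False)}
  have hins : ∀ w : Fin n, c ≤ (w : ℕ) → (w : ℕ) < c + 3 → ∀ s ∈ B, insert w s ∈ B := by
    rintro w hw1 hw2 s ⟨h1, h2, h3⟩
    refine ⟨?_, ?_, ?_⟩
    · intro i hi j hj h4 h5
      rw [Finset.mem_insert] at hi hj
      rcases hi with rfl | hi <;> rcases hj with rfl | hj <;> first | omega | exact h1 i hi j hj h4 h5
    · intro i hi h4 h5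
      rw [Finset.mem_insert] at hi
      rcases hi with rfl | hi <;> first | omega | exact h2 i hi h4 h5
    · intro i hi j hj h4 h5 h6
      rw [Finset.mem_insert] at hi hj
      rcases hi with rfl | hi <;> rcases hj with rfl | hj <;>
        first | omega | exact h3 i hi j hj h4 h5 h6
  have key := step (B := B) (by
      rintro s ⟨h1, h2, h3⟩ t ht
      exact ⟨fun i hi j hj => h1 i (ht hi) j (ht hj), fun i hi => h2 i (ht hi),
        fun i hi j hj => h3 i (ht hi) j (ht hj)⟩) a b x y z
    (by simp [a, x, Fin.ext_iff] <;> omega) (by simp [a, y, Fin.ext_iff] <;> omega)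
    (by simp [a, z, Fin.ext_iff] <;> omega) (by simp [b, x, Fin.ext_iff] <;> omega)
    (by simp [b, y, Fin.ext_iff]) (by simp [b, z, Fin.ext_iff])
    (by simp [x, y, Fin.ext_iff]) (by simp [x, z, Fin.ext_iff]) (by simp [y, z, Fin.ext_iff])
    (hins x (by simp [x]) (by simp [x])) (hins y (by simp [y]) (by simp [y]))
    (hins z (by simp [z]) (by simp [z]))
  have e1 : {s ∈ B | ¬ (a ∈ s ∧ x ∈ s) ∧ ¬ (x ∈ s ∧ y ∈ s) ∧ ¬ (y ∈ s ∧ z ∈ s) ∧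
        ¬ (z ∈ s ∧ b ∈ s)} = Kc n (c + 3) := by
    ext s
    constructor
    · rintro ⟨⟨h1, h2, h3⟩, h4, h5, h6, h7⟩
      refine ⟨?_, ?_, ?_, ?_⟩
      · intro i hi j hj h8 h9
        by_cases q1 : (j : ℕ) < c
        · exact h1 i hi j hj h8 q1
        · have : (j : ℕ) = c ∨ (j : ℕ) = c + 1 ∨ (j : ℕ) = c + 2 := by omega
          rcases this with q | q | q
          · have hi' : i = a := Fin.ext (by simp [a]; omega)
            have hj' : j = x := Fin.ext (by simp [x]; omega)
            exact h4 ⟨hi' ▸ hi, hj' ▸ hj⟩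
          · have hi' : i = x := Fin.ext (by simp [x]; omega)
            have hj' : j = y := Fin.ext (by simp [y]; omega)
            exact h5 ⟨hi' ▸ hi, hj' ▸ hj⟩
          · have hi' : i = y := Fin.ext (by simp [y]; omega)
            have hj' : j = z := Fin.ext (by simp [z]; omega)
            exact h6 ⟨hi' ▸ hi, hj' ▸ hj⟩
      · intro i hi j hj h8 h9
        have hi' : i = b := Fin.ext (by simp [b]; omega)
        have hj' : j = z := Fin.ext (by simp [z]; omega)
        exact h7 ⟨hj' ▸ hj, hi' ▸ hi⟩
      · intro i hi h8 h9
        exact h2 i hi h8 (by omega)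
      · intro i hi j hj h8 h9 h10
        exact h3 i hi j hj h8 h9 (by omega)
    · rintro ⟨h1, h2, h3, h4⟩
      refine ⟨⟨?_, ?_, ?_⟩, ?_, ?_, ?_, ?_⟩
      · exact fun i hi j hj h5 h6 => h1 i hi j hj h5 (by omega)
      · exact fun i hi h5 h6 => h3 i hi h5 (by omega)
      · exact fun i hi j hj h5 h6 h7 => h4 i hi j hj h5 h6 (by omega)
      · exact fun h => h1 _ h.1 _ h.2 (by simp [a, x]; omega) (by simp [x])
      · exact fun h => h1 _ h.1 _ h.2 (by simp [x, y]) (by simp [y])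
      · exact fun h => h1 _ h.1 _ h.2 (by simp [y, z]) (by simp [z])
      · exact fun h => h2 _ h.2 _ h.1 (by simp [b]) (by simp [z])
  have e2 : {s ∈ B | ¬ (a ∈ s ∧ b ∈ s) ∧ ¬ (x ∈ s ∧ y ∈ s) ∧ z ∉ s} = Kc n c := by
    ext s
    constructor
    · rintro ⟨⟨h1, h2, h3⟩, h4, h5, h6⟩
      refine ⟨h1, ?_, ?_, ?_⟩
      · intro i hi j hj h8 h9
        have hi' : i = b := Fin.ext (by simp [b]; omega)
        have hj' : j = a := Fin.ext (by simp [a]; omega)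
        exact h4 ⟨hj' ▸ hj, hi' ▸ hi⟩
      · intro i hi h8 h9
        by_cases q : c + 3 ≤ (i : ℕ)
        · exact h2 i hi q h9
        · have hi' : i = z := Fin.ext (by simp [z]; omega)
          exact h6 (hi' ▸ hi)
      · intro i hi j hj h8 h9 h10
        by_cases q : c + 3 ≤ (i : ℕ)
        · exact h3 i hi j hj q h9 h10
        · have hi' : i = x := Fin.ext (by simp [x]; omega)
          have hj' : j = y := Fin.ext (by simp [y]; omega)
          exact h5 ⟨hi' ▸ hi, hj' ▸ hj⟩
    · rintro ⟨h1, h2, h3, h4⟩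
      refine ⟨⟨h1, ?_, ?_⟩, ?_, ?_, ?_⟩
      · exact fun i hi h5 h6 => h3 i hi (by omega) h6
      · exact fun i hi j hj h5 h6 h7 => h4 i hi j hj (by omega) h6 h7
      · exact fun h => h2 _ h.2 _ h.1 (by simp [b]) (by simp [a]; omega)
      · exact fun h => h4 _ h.1 _ h.2 (by simp [x]) (by simp [x, y]) (by simp [x])
      · exact fun h => h3 _ h (by simp [z]) (by simp [z])
  rw [e1, e2] at key
  exact key

theorem Kc_steps (n c j : ℕ) (hc : 1 ≤ c) (hn : c + 3 * j ≤ n) :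
    Nonempty (ContinuousMap.HomotopyEquiv (realization (Kc n (c + 3 * j)))
      (realization (Kc n c))) := by
  induction j with
  | zero => exact ⟨ContinuousMap.HomotopyEquiv.refl _⟩
  | succ j ih =>
    obtain ⟨e⟩ := ih (by omega)
    obtain ⟨e'⟩ := Kc_step n (c + 3 * j) (by omega) (by omega)
    exact ⟨e'.trans e⟩

theorem matching_eq (n : ℕ) (hn : 3 ≤ n) :
    Nonempty (ContinuousMap.HomotopyEquiv (realization (matchingComplex (SimpleGraph.cycleGraph n)))
      (realization (Kc n n))) := by
  obtain ⟨m, rfl⟩ : ∃ m, n = m + 3 := ⟨n - 3, by omega⟩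
  have hval : ∀ i : Fin (m + 3), ((i + 1 : Fin (m + 3)) : ℕ) = if (i : ℕ) = m + 2 then 0 else (i : ℕ) + 1 := by
    intro i
    rw [Fin.val_add_one]
    simp [Fin.ext_iff]
  have hinj : Function.Injective (fun i : Fin (m + 3) => s(i, i + 1)) := by
    intro i j h
    simp only [Sym2.eq_iff] at h
    rcases h with h | ⟨h1, h2⟩
    · exact h.1
    · exfalso
      have h1 := congrArg Fin.val h1
      have h2 := congrArg Fin.val h2
      rw [hval] at h1 h2
      split_ifs at h1 h2 <;> omega
  have hadj : ∀ i j : Fin (m + 3), (SimpleGraph.cycleGraph (m + 3)).Adj i j ↔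
      (j = i + 1 ∨ i = j + 1) := by
    intro i j
    rw [SimpleGraph.cycleGraph_adj]
    rw [sub_eq_iff_eq_add, sub_eq_iff_eq_add, add_comm 1 j, add_comm 1 i]
    tauto
  refine relabel ⟨_, hinj⟩ _ _ ?_
  intro s
  constructor
  · rintro ⟨h1, h2⟩
    refine ⟨Finset.univ.filter fun i => s(i, i + 1) ∈ s, ⟨?_, ?_, ?_, ?_⟩, ?_⟩
    · intro i hi j hj h3 h4
      simp only [Finset.mem_filter, Finset.mem_univ, true_and] at hi hj
      have hj1 : j = i + 1 := Fin.ext (by rw [hval]; split_ifs <;> omega)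
      refine h2 _ hi _ hj (fun h => ?_) j (by simp [hj1]) (by simp)
      have := congrArg Fin.val (hinj h)
      omega
    · intro i hi j hj h3 h4
      simp only [Finset.mem_filter, Finset.mem_univ, true_and] at hi hj
      have hj1 : i = j + 1 := Fin.ext (by rw [hval]; split_ifs <;> omega)
      refine h2 _ hj _ hi (fun h => ?_) i (by simp [hj1]) (by simp)
      have := congrArg Fin.val (hinj h)
      omega
    · intro i hi h3; omega
    · intro i hi j hj h3; omega
    · ext e
      simp only [Finset.mem_map, Finset.mem_filter, Finset.mem_univ, true_and,
        Function.Embedding.coeFn_mk]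
      constructor
      · intro he
        have h3 := h1 e he
        induction e with
        | _ i j =>
          rw [SimpleGraph.mem_edgeSet, hadj] at h3
          rcases h3 with rfl | rfl
          · exact ⟨i, he, rfl⟩
          · exact ⟨j, by rwa [Sym2.eq_swap], Sym2.eq_swap⟩
      · rintro ⟨i, hi, rfl⟩
        exact hi
  · rintro ⟨t, ⟨h1, h2, -, -⟩, rfl⟩
    refine ⟨?_, ?_⟩
    · intro e he
      simp only [Finset.mem_map, Function.Embedding.coeFn_mk] at he
      obtain ⟨i, hi, rfl⟩ := he
      rw [SimpleGraph.mem_edgeSet, hadj]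
      simp
    · intro e he f hf hne v hve hvf
      simp only [Finset.mem_map, Function.Embedding.coeFn_mk] at he hf
      obtain ⟨i, hi, rfl⟩ := he
      obtain ⟨j, hj, rfl⟩ := hf
      have hij : i ≠ j := fun h => hne (h ▸ rfl)
      have key : ∀ i ∈ t, ∀ j ∈ t, i = j + 1 → False := by
        intro i hi j hj h
        have h := congrArg Fin.val h
        rw [hval] at h
        split_ifs at h with h5
        · exact h2 i hi j hj h (by omega)
        · exact h1 j hj i hi h.symm i.2
      simp only [Sym2.mem_iff] at hve hvf
      rcases hve with rfl | rfl <;> rcases hvf with h | h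
      · exact hij h
      · exact key _ hi _ hj h
      · exact key _ hj _ hi h.symm
      · exact hij (add_right_cancel h)


/-- Coordinates of a point of the sphere. -/
def co {n : ℕ} (x : nSphere n) : Fin (n + 1) → ℝ := fun i => x.1 i

theorem co_cont {n : ℕ} : Continuous (co (n := n)) := by
  refine continuous_pi fun i => ?_
  exact ((PiLp.continuous_apply 2 (fun _ : Fin (n + 1) => ℝ) i).comp continuous_subtype_val)

theorem co_inj {n : ℕ} {x y : nSphere n} (h : co x = co y) : x = y := by
  apply Subtype.ext
  ext i
  exact congrFun h i

theorem norm_co {n : ℕ} (x : nSphere n) : ‖WithLp.toLp 2 (co x)‖ = 1 := by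
  have h : ‖x.1‖ = 1 := mem_sphere_zero_iff_norm.1 x.2
  exact h

theorem co_ne {n : ℕ} (x : nSphere n) : co x ≠ 0 := by
  intro h
  have := norm_co x
  rw [h] at this
  simp at this

theorem co_pt (n : ℕ) : co (spherePt n) = Pi.single 0 1 := by
  funext i
  simp [co, spherePt, Pi.single_apply]

/-- Normalization to the sphere. -/
def nrm {n : ℕ} (v : Fin (n + 1) → ℝ) (hv : v ≠ 0) : nSphere n :=
  ⟨‖WithLp.toLp 2 v‖⁻¹ • WithLp.toLp 2 v, by
    have : ‖WithLp.toLp 2 v‖ ≠ 0 := by simpa using hv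
    rw [mem_sphere_zero_iff_norm, norm_smul, norm_inv, norm_norm, inv_mul_cancel₀ this]⟩

theorem co_nrm {n : ℕ} (v : Fin (n + 1) → ℝ) (hv : v ≠ 0) :
    co (nrm v hv) = ‖WithLp.toLp 2 v‖⁻¹ • v := by
  funext i
  simp [co, nrm]

theorem co_nrm' {n : ℕ} (v : Fin (n + 1) → ℝ) (hv : v ≠ 0) :
    ∃ c : ℝ, 0 < c ∧ co (nrm v hv) = c • v :=
  ⟨_, inv_pos.2 (norm_pos_iff.2 (by simpa using hv)), co_nrm v hv⟩

theorem nrm_congr {n : ℕ} {v w : Fin (n + 1) → ℝ} (hv : v ≠ 0) (hw : w ≠ 0) (c : ℝ) (hc : 0 < c)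
    (h : v = c • w) : nrm v hv = nrm w hw := by
  apply co_inj
  subst h
  rw [co_nrm, co_nrm, WithLp.toLp_smul, norm_smul, smul_smul]
  congr 1
  rw [Real.norm_of_nonneg hc.le]
  field_simp

theorem nrm_co {n : ℕ} (x : nSphere n) (h : co x ≠ 0) : nrm (co x) h = x := by
  apply co_inj
  rw [co_nrm, norm_co]
  simp

theorem nrm_cont {n : ℕ} {Z : Type*} [TopologicalSpace Z] (v : Z → Fin (n + 1) → ℝ)
    (hv : Continuous v) (h0 : ∀ z, v z ≠ 0) : Continuous fun z => nrm (v z) (h0 z) := by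
  refine Continuous.subtype_mk ?_ _
  have h1 : Continuous fun z => WithLp.toLp 2 (v z) :=
    (PiLp.continuous_toLp 2 (fun _ : Fin (n + 1) => ℝ)).comp hv
  refine Continuous.smul (Continuous.inv₀ h1.norm ?_) h1
  intro z
  simpa using h0 z

/-- Weights that can be normalized to a point of the realization. -/
def Good {α : Type*} (K : Set (Finset α)) (w : α → ℝ) : Prop :=
  (∀ a, 0 ≤ w a) ∧ (∃ a, w a ≠ 0) ∧ ∃ s ∈ K, Function.support w ⊆ ↑s

theorem Good.sum_pos {α : Type*} [Fintype α] {K : Set (Finset α)} {w : α → ℝ} (h : Good K w) :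
    0 < ∑ a, w a := by
  obtain ⟨h0, ⟨a, ha⟩, -⟩ := h
  exact Finset.sum_pos' (fun a _ => h0 a) ⟨a, Finset.mem_univ _, lt_of_le_of_ne (h0 a) (Ne.symm ha)⟩

/-- Normalization to the realization. -/
def wn {α : Type*} [Fintype α] {K : Set (Finset α)} (w : α → ℝ) (h : Good K w) : realization K :=
  mk (fun a => w a / ∑ b, w b) (fun a => div_nonneg (h.1 a) h.sum_pos.le)
    (by rw [← Finset.sum_div, div_self h.sum_pos.ne'])
    (by
      obtain ⟨-, -, s, hs, h2⟩ := h
      refine ⟨s, hs, fun a ha => h2 fun h3 => ha ?_⟩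
      simp [h3])

theorem wn_val {α : Type*} [Fintype α] {K : Set (Finset α)} (w : α → ℝ) (h : Good K w) (a : α) :
    (wn w h).1 a = w a / ∑ b, w b := rfl

theorem wn_congr {α : Type*} [Fintype α] {K : Set (Finset α)} {w w' : α → ℝ} (h : Good K w)
    (h' : Good K w') (c : ℝ) (hc : 0 < c) (hw : ∀ a, w a = c * w' a) : wn w h = wn w' h' := by
  apply Subtype.ext
  funext a
  rw [wn_val, wn_val]
  simp_rw [hw]
  rw [← Finset.mul_sum, mul_div_mul_left _ _ hc.ne']

theorem wn_self {α : Type*} [Fintype α] {K : Set (Finset α)} (f : realization K) (h : Good K f.1) :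
    wn f.1 h = f := by
  apply Subtype.ext
  funext a
  rw [wn_val, (mem_iff.1 f.2).2.1, div_one]

theorem good_self {α : Type*} [Fintype α] {K : Set (Finset α)} (f : realization K) :
    Good K f.1 := by
  obtain ⟨h0, h1, h2⟩ := mem_iff.1 f.2
  refine ⟨h0, ?_, h2⟩
  by_contra! h
  simp [h] at h1

theorem wn_cont {α : Type*} [Fintype α] {K : Set (Finset α)} {Z : Type*} [TopologicalSpace Z]
    (w : Z → α → ℝ) (hw : ∀ a, Continuous fun z => w z a) (h0 : ∀ z, Good K (w z)) :
    Continuous fun z => wn (w z) (h0 z) := by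
  refine Continuous.subtype_mk ?_ _
  refine continuous_pi fun a => ?_
  exact (hw a).div (continuous_finsetSum _ fun b _ => hw b) fun z => (h0 z).sum_pos.ne'

/-- Positive and negative parts. -/
def pm {k : ℕ} (v : Fin k → ℝ) (p : Fin k × Bool) : ℝ :=
  if p.2 then max (v p.1) 0 else max (-(v p.1)) 0

theorem pm_nonneg {k : ℕ} (v : Fin k → ℝ) (p : Fin k × Bool) : 0 ≤ pm v p := by
  unfold pm; split_ifs <;> exact le_max_right _ _

theorem pm_sub {k : ℕ} (v : Fin k → ℝ) (i : Fin k) : pm v (i, true) - pm v (i, false) = v i := by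
  simp only [pm, if_true, Bool.false_eq_true, if_false]
  rcases le_total (v i) 0 with h | h
  · rw [max_eq_right h, max_eq_left (by linarith)]; ring
  · rw [max_eq_left h, max_eq_right (by linarith)]; ring

theorem pm_add {k : ℕ} (v : Fin k → ℝ) (i : Fin k) : pm v (i, true) + pm v (i, false) = |v i| := by
  simp only [pm, if_true, Bool.false_eq_true, if_false]
  rcases le_total (v i) 0 with h | h
  · rw [max_eq_right h, max_eq_left (by linarith), abs_of_nonpos h]; ring
  · rw [max_eq_left h, max_eq_right (by linarith), abs_of_nonneg h]; ring

theorem pm_or {k : ℕ} (v : Fin k → ℝ) (i : Fin k) : pm v (i, true) = 0 ∨ pm v (i, false) = 0 := by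
  simp only [pm, if_true, Bool.false_eq_true, if_false]
  rcases le_total (v i) 0 with h | h
  · left; rw [max_eq_right h]
  · right; rw [max_eq_right (by linarith)]

theorem pm_smul {k : ℕ} (v : Fin k → ℝ) (c : ℝ) (hc : 0 ≤ c) (p : Fin k × Bool) :
    pm (fun i => c * v i) p = c * pm v p := by
  unfold pm
  split_ifs
  · rw [mul_max_of_nonneg _ _ hc, mul_zero]
  · rw [mul_max_of_nonneg _ _ hc, mul_zero, mul_neg]

theorem pm_diff {k : ℕ} (f : Fin k × Bool → ℝ) (h0 : ∀ p, 0 ≤ f p)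
    (h : ∀ i, f (i, true) = 0 ∨ f (i, false) = 0) (p : Fin k × Bool) :
    pm (fun i => f (i, true) - f (i, false)) p = f p := by
  obtain ⟨i, b⟩ := p
  have h1 := h0 (i, true)
  have h2 := h0 (i, false)
  cases b
  · simp only [pm, Bool.false_eq_true, if_false]
    rcases h i with h | h
    · rw [h, max_eq_left (by linarith)]; ring
    · rw [h, max_eq_right (by linarith)]
  · simp only [pm, if_true]
    rcases h i with h | h
    · rw [h, max_eq_right (by linarith)]
    · rw [h, max_eq_left (by linarith)]; ring

/-- The boundary of the cross-polytope. -/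
def Cr (k : ℕ) : Set (Finset (Fin k × Bool)) := {s | ∀ i, ¬ ((i, true) ∈ s ∧ (i, false) ∈ s)}

theorem good_Cr {k : ℕ} {w : Fin k × Bool → ℝ} (h0 : ∀ p, 0 ≤ w p) (h1 : ∃ p, w p ≠ 0)
    (h2 : ∀ i, w (i, true) = 0 ∨ w (i, false) = 0) : Good (Cr k) w := by
  classical
  refine ⟨h0, h1, Finset.univ.filter fun p => w p ≠ 0, ?_, ?_⟩
  · intro i hi
    simp only [Finset.mem_filter, Finset.mem_univ, true_and] at hi
    rcases h2 i with h | h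
    · exact hi.1 h
    · exact hi.2 h
  · intro p hp
    simpa using hp

theorem Cr_or {k : ℕ} (f : realization (Cr k)) (i : Fin k) :
    f.1 (i, true) = 0 ∨ f.1 (i, false) = 0 := by
  obtain ⟨-, -, s, hs, h⟩ := mem_iff.1 f.2
  by_contra! hc
  exact hs i ⟨by simpa using h hc.1, by simpa using h hc.2⟩

theorem cross_sphere (m : ℕ) :
    Nonempty (ContinuousMap.HomotopyEquiv (realization (Cr (m + 1))) (nSphere m)) := by
  have hne : ∀ f : realization (Cr (m + 1)), (fun i => f.1 (i, true) - f.1 (i, false)) ≠ 0 := by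
    intro f hf
    obtain ⟨p, hp⟩ := (good_self f).2.1
    apply hp
    rw [← pm_diff f.1 f.2.1 (Cr_or f) p]
    rw [hf]
    simp [pm]
  have hg : ∀ x : nSphere m, Good (Cr (m + 1)) (pm (co x)) := by
    intro x
    refine good_Cr (pm_nonneg _) ?_ (pm_or _)
    by_contra! h
    apply co_ne x
    funext i
    rw [← pm_sub (co x) i, h, h]
    simp
  refine ⟨Homeomorph.toHomotopyEquiv
    { toFun := fun f => nrm _ (hne f)
      invFun := fun x => wn _ (hg x)
      left_inv := ?_
      right_inv := ?_
      continuous_toFun := ?_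
      continuous_invFun := ?_ }⟩
  · intro f
    simp only
    obtain ⟨c, hc, h⟩ := co_nrm' _ (hne f)
    refine (wn_congr _ (good_self f) c hc ?_).trans (wn_self f _)
    intro p
    rw [h, ← pm_diff f.1 f.2.1 (Cr_or f) p]
    exact pm_smul _ c hc.le p
  · intro x
    simp only
    refine (nrm_congr _ (co_ne x) _ (inv_pos.2 (hg x).sum_pos) ?_).trans (nrm_co x _)
    funext i
    rw [wn_val, wn_val, ← sub_div, pm_sub, Pi.smul_apply, smul_eq_mul, div_eq_inv_mul]
  · apply nrm_cont
    refine continuous_pi fun i => ?_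
    exact ((continuous_apply (i, true)).comp continuous_subtype_val).sub
      ((continuous_apply (i, false)).comp continuous_subtype_val)
  · apply wn_cont
    intro p
    have : Continuous fun x : nSphere m => co x p.1 := (continuous_apply p.1).comp co_cont
    unfold pm
    split_ifs <;> fun_prop

/-- Hausdorff model of the wedge. -/
def W (m : ℕ) : Type := {p : nSphere m × nSphere m // p.1 = spherePt m ∨ p.2 = spherePt m}

instance (m : ℕ) : TopologicalSpace (W m) := instTopologicalSpaceSubtype

instance (m : ℕ) : CompactSpace (nSphere m) := by
  unfold nSphere; infer_instance

instance (m : ℕ) : T2Space (nSphere m) := by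
  unfold nSphere; infer_instance

instance (m : ℕ) : T2Space (W m) := by
  unfold W; infer_instance

instance (m : ℕ) : CompactSpace (WedgeOfSpheres (fun _ : Fin 2 => m)) := by
  unfold WedgeOfSpheres; infer_instance

/-- The comparison map before passing to the quotient. -/
def toW0 (m : ℕ) : (Σ _ : Fin 2, nSphere m) → W m := fun a =>
  if a.1 = 0 then ⟨(a.2, spherePt m), Or.inr rfl⟩ else ⟨(spherePt m, a.2), Or.inl rfl⟩

theorem toW0_cont (m : ℕ) : Continuous (toW0 m) := by
  rw [continuous_sigma_iff]
  intro i
  unfold toW0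
  by_cases hi : i = 0
  · simp only [hi]
    exact Continuous.subtype_mk (by fun_prop) _
  · simp only [hi]
    exact Continuous.subtype_mk (by fun_prop) _

theorem wedge_W (m : ℕ) :
    Nonempty (ContinuousMap.HomotopyEquiv (W m) (WedgeOfSpheres (fun _ : Fin 2 => m))) := by
  let g : WedgeOfSpheres (fun _ : Fin 2 => m) → W m := Quot.lift (toW0 m) (by
    rintro a b ⟨i, j, rfl, rfl⟩
    fin_cases i <;> fin_cases j <;> rfl)
  have hg : Continuous g := continuous_quot_lift _ (toW0_cont m)
  have hsurj : Function.Surjective g := by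
    rintro ⟨⟨x, y⟩, h⟩
    rcases h with h | h
    · refine ⟨Quot.mk _ ⟨1, y⟩, ?_⟩
      simp only at h
      subst h
      rfl
    · refine ⟨Quot.mk _ ⟨0, x⟩, ?_⟩
      simp only at h
      subst h
      rfl
  have hinj : Function.Injective g := by
    intro a b
    induction a using Quot.ind with | _ a =>
    induction b using Quot.ind with | _ b =>
    obtain ⟨i, x⟩ := a
    obtain ⟨j, y⟩ := b
    intro h
    have h : toW0 m ⟨i, x⟩ = toW0 m ⟨j, y⟩ := h
    have h := congrArg Subtype.val h
    fin_cases i <;> fin_cases j <;> simp [toW0] at h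
    · rw [h]
    · obtain ⟨rfl, rfl⟩ := h
      exact Quot.sound ⟨0, 1, rfl, rfl⟩
    · obtain ⟨rfl, rfl⟩ := h
      exact Quot.sound ⟨1, 0, rfl, rfl⟩
    · rw [h]
  exact ⟨(Continuous.homeoOfEquivCompactToT2
    (f := Equiv.ofBijective g ⟨hinj, hsurj⟩) hg).symm.toHomotopyEquiv⟩


/-- The join of three points with the boundary of a cross-polytope. -/
def Tr (m : ℕ) : Set (Finset (Fin 3 ⊕ Fin m × Bool)) :=
  {s | (∀ i j, Sum.inl i ∈ s → Sum.inl j ∈ s → i = j) ∧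
    ∀ i, ¬ (Sum.inr (i, true) ∈ s ∧ Sum.inr (i, false) ∈ s)}

theorem good_Tr {m : ℕ} {w : Fin 3 ⊕ Fin m × Bool → ℝ} (h0 : ∀ p, 0 ≤ w p) (h1 : ∃ p, w p ≠ 0)
    (h3 : ∀ i j, i ≠ j → w (Sum.inl i) = 0 ∨ w (Sum.inl j) = 0)
    (h2 : ∀ i, w (Sum.inr (i, true)) = 0 ∨ w (Sum.inr (i, false)) = 0) : Good (Tr m) w := by
  classical
  refine ⟨h0, h1, Finset.univ.filter fun p => w p ≠ 0, ⟨?_, ?_⟩, ?_⟩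
  · intro i j hi hj
    simp only [Finset.mem_filter, Finset.mem_univ, true_and] at hi hj
    by_contra hne
    rcases h3 i j hne with h | h
    · exact hi h
    · exact hj h
  · intro i hi
    simp only [Finset.mem_filter, Finset.mem_univ, true_and] at hi
    rcases h2 i with h | h
    · exact hi.1 h
    · exact hi.2 h
  · intro p hp
    simpa using hp

theorem Tr_or {m : ℕ} (f : realization (Tr m)) (i : Fin m) :
    f.1 (Sum.inr (i, true)) = 0 ∨ f.1 (Sum.inr (i, false)) = 0 := by
  obtain ⟨-, -, s, hs, h⟩ := mem_iff.1 f.2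
  by_contra! hc
  exact hs.2 i ⟨by simpa using h hc.1, by simpa using h hc.2⟩

theorem Tr_or' {m : ℕ} (f : realization (Tr m)) (i j : Fin 3) (hij : i ≠ j) :
    f.1 (Sum.inl i) = 0 ∨ f.1 (Sum.inl j) = 0 := by
  obtain ⟨-, -, s, hs, h⟩ := mem_iff.1 f.2
  by_contra! hc
  exact hij (hs.1 i j (by simpa using h hc.1) (by simpa using h hc.2))

theorem Tr_sum {m : ℕ} (f : realization (Tr m)) :
    f.1 (Sum.inl 0) + f.1 (Sum.inl 1) + f.1 (Sum.inl 2) + ∑ p, f.1 (Sum.inr p) = 1 := by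
  have := (mem_iff.1 f.2).2.1
  rw [Fintype.sum_sum_type, Fin.sum_univ_three] at this
  exact this

/-- The vector whose normalization gives the map to one of the spheres. -/
def vA {m : ℕ} (f : Fin 3 ⊕ Fin m × Bool → ℝ) (j : Fin 3) : Fin (m + 1) → ℝ :=
  Fin.cons (1 - 2 * f (Sum.inl j))
    (fun i => f (Sum.inl j) * (f (Sum.inr (i, true)) - f (Sum.inr (i, false))))

theorem vA_zero {m : ℕ} (f : Fin 3 ⊕ Fin m × Bool → ℝ) (j : Fin 3) (h : f (Sum.inl j) = 0) :
    vA f j = Pi.single 0 1 := by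
  funext i
  refine Fin.cases ?_ (fun i => ?_) i
  · simp [vA, h]
  · simp [vA, h]

theorem vA_ne {m : ℕ} (f : realization (Tr m)) (j : Fin 3) : vA f.1 j ≠ 0 := by
  intro h
  have h1 : 1 - 2 * f.1 (Sum.inl j) = 0 := congrFun h 0
  have h2 : f.1 (Sum.inl j) = 1 / 2 := by linarith
  have h3 : ∀ p, f.1 (Sum.inr p) = 0 := by
    rintro ⟨i, b⟩
    have h4 : f.1 (Sum.inl j) * (f.1 (Sum.inr (i, true)) - f.1 (Sum.inr (i, false))) = 0 :=
      congrFun h i.succ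
    rw [h2] at h4
    rcases Tr_or f i with h5 | h5 <;> cases b <;> linarith
  have h5 := Tr_sum f
  simp only [h3, Finset.sum_const_zero, add_zero] at h5
  have h01 := Tr_or' f 0 1 (by decide)
  have h02 := Tr_or' f 0 2 (by decide)
  have h12 := Tr_or' f 1 2 (by decide)
  fin_cases j <;> simp only [Fin.zero_eta, Fin.mk_one, Fin.reduceFinMk] at h2 <;>
    rcases h01 with h01 | h01 <;> rcases h02 with h02 | h02 <;> rcases h12 with h12 | h12 <;>
    linarith

theorem vA_cont {m : ℕ} {Z : Type*} [TopologicalSpace Z] (f : Z → Fin 3 ⊕ Fin m × Bool → ℝ)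
    (hf : ∀ a, Continuous fun z => f z a) (j : Fin 3) : Continuous fun z => vA (f z) j := by
  refine continuous_pi fun i => ?_
  have h1 := hf (Sum.inl j)
  refine Fin.cases ?_ (fun i => ?_) i
  · simp only [vA, Fin.cons_zero]
    fun_prop
  · have h2 := hf (Sum.inr (i, true))
    have h3 := hf (Sum.inr (i, false))
    simp only [vA, Fin.cons_succ]
    fun_prop

theorem real_cont {α : Type*} {K : Set (Finset α)} (a : α) :
    Continuous fun f : realization K => f.1 a :=
  (continuous_apply a).comp continuous_subtype_val

theorem vA_or {m : ℕ} (f : realization (Tr m)) :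
    nrm (vA f.1 0) (vA_ne f 0) = spherePt m ∨ nrm (vA f.1 2) (vA_ne f 2) = spherePt m := by
  have key : ∀ j, f.1 (Sum.inl j) = 0 → nrm (vA f.1 j) (vA_ne f j) = spherePt m := by
    intro j hj
    refine (nrm_congr _ (co_ne _) 1 one_pos ?_).trans (nrm_co (spherePt m) (co_ne _))
    rw [vA_zero _ _ hj, co_pt, one_smul]
  rcases Tr_or' f 0 2 (by decide) with h | h
  · exact Or.inl (key 0 h)
  · exact Or.inr (key 2 h)

/-- The map to the wedge. -/
def Phi (m : ℕ) : C(realization (Tr m), W m) :=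
  ⟨fun f => ⟨(nrm (vA f.1 0) (vA_ne f 0), nrm (vA f.1 2) (vA_ne f 2)), vA_or f⟩,
    Continuous.subtype_mk ((nrm_cont _ (vA_cont _ real_cont 0) _).prodMk
      (nrm_cont _ (vA_cont _ real_cont 2) _)) _⟩

/-- The weights for the map from the wedge. -/
def wt {m : ℕ} (x y : Fin (m + 1) → ℝ) : Fin 3 ⊕ Fin m × Bool → ℝ :=
  Sum.elim ![max (-(x 0)) 0, max (x 0) 0 + max (y 0) 0 - 1, max (-(y 0)) 0]
    (fun p => pm (fun i => x (Fin.succ i)) p + pm (fun i => y (Fin.succ i)) p)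

theorem pm_zero {k : ℕ} (p : Fin k × Bool) : pm (fun _ => 0) p = 0 := by
  unfold pm; split_ifs <;> simp

theorem wt_left {m : ℕ} (x : Fin (m + 1) → ℝ) : wt x (Pi.single 0 1) =
    Sum.elim ![max (-(x 0)) 0, max (x 0) 0, 0] (pm (fun i => x (Fin.succ i))) := by
  funext a
  rcases a with a | a
  · fin_cases a <;> simp [wt]
  · simp [wt, pm_zero]

theorem wt_right {m : ℕ} (y : Fin (m + 1) → ℝ) : wt (Pi.single 0 1) y =
    Sum.elim ![0, max (y 0) 0, max (-(y 0)) 0] (pm (fun i => y (Fin.succ i))) := by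
  funext a
  rcases a with a | a
  · fin_cases a <;> simp [wt]
  · simp [wt, pm_zero]

theorem max_or (t : ℝ) : max (-t) 0 = 0 ∨ max t 0 = 0 := by
  rcases le_total t 0 with h | h
  · right; simpa using h
  · left; simpa using h

theorem max_ne (t : ℝ) (ht : t ≠ 0) : max (-t) 0 ≠ 0 ∨ max t 0 ≠ 0 := by
  rcases lt_or_gt_of_ne ht with h | h
  · left; rw [max_eq_left (by linarith)]; linarith
  · right; rw [max_eq_left (by linarith)]; linarith

theorem pm_ne {k : ℕ} (v : Fin k → ℝ) (i : Fin k) (hi : v i ≠ 0) : ∃ p, pm v p ≠ 0 := by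
  by_contra! h
  apply hi
  rw [← pm_sub v i, h, h, sub_zero]

theorem good_left {m : ℕ} (x : Fin (m + 1) → ℝ) (hx : x ≠ 0) :
    Good (Tr m) (wt x (Pi.single 0 1)) := by
  rw [wt_left]
  refine good_Tr ?_ ?_ ?_ ?_
  · rintro (a | a)
    · fin_cases a <;> simp
    · exact pm_nonneg (fun i => x (Fin.succ i)) a
  · obtain ⟨i, hi⟩ := Function.ne_iff.1 hx
    rcases Fin.eq_zero_or_eq_succ i with rfl | ⟨j, rfl⟩
    · rcases max_ne _ hi with h | h
      · exact ⟨Sum.inl 0, h⟩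
      · exact ⟨Sum.inl 1, h⟩
    · obtain ⟨p, hp⟩ := pm_ne (fun i => x (Fin.succ i)) j hi
      exact ⟨Sum.inr p, hp⟩
  · intro i j hij
    have := max_or (x 0)
    fin_cases i <;> fin_cases j <;> simp at hij ⊢ <;> simp at this <;> tauto
  · intro i
    exact pm_or (fun i => x (Fin.succ i)) i

theorem good_right {m : ℕ} (x : Fin (m + 1) → ℝ) (hx : x ≠ 0) :
    Good (Tr m) (wt (Pi.single 0 1) x) := by
  rw [wt_right]
  refine good_Tr ?_ ?_ ?_ ?_
  · rintro (a | a)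
    · fin_cases a <;> simp
    · exact pm_nonneg (fun i => x (Fin.succ i)) a
  · obtain ⟨i, hi⟩ := Function.ne_iff.1 hx
    rcases Fin.eq_zero_or_eq_succ i with rfl | ⟨j, rfl⟩
    · rcases max_ne _ hi with h | h
      · exact ⟨Sum.inl 2, h⟩
      · exact ⟨Sum.inl 1, h⟩
    · obtain ⟨p, hp⟩ := pm_ne (fun i => x (Fin.succ i)) j hi
      exact ⟨Sum.inr p, hp⟩
  · intro i j hij
    have := max_or (x 0)
    fin_cases i <;> fin_cases j <;> simp at hij ⊢ <;> simp at this <;> tauto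
  · intro i
    exact pm_or (fun i => x (Fin.succ i)) i

theorem good_W {m : ℕ} (p : W m) : Good (Tr m) (wt (co p.1.1) (co p.1.2)) := by
  rcases p.2 with h | h
  · rw [h, co_pt]
    exact good_right _ (co_ne _)
  · rw [h, co_pt]
    exact good_left _ (co_ne _)

theorem wt_cont {m : ℕ} {Z : Type*} [TopologicalSpace Z] (x y : Z → Fin (m + 1) → ℝ)
    (hx : Continuous x) (hy : Continuous y) (a : Fin 3 ⊕ Fin m × Bool) :
    Continuous fun z => wt (x z) (y z) a := by
  have h1 : ∀ i, Continuous fun z => x z i := fun i => (continuous_apply i).comp hx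
  have h2 : ∀ i, Continuous fun z => y z i := fun i => (continuous_apply i).comp hy
  have h10 := h1 0
  have h20 := h2 0
  rcases a with a | ⟨i, b⟩
  · fin_cases a <;> simp only [wt, Sum.elim_inl, Fin.zero_eta, Fin.mk_one, Fin.reduceFinMk,
      Matrix.cons_val] <;> fun_prop
  · have h3 := h1 i.succ
    have h4 := h2 i.succ
    cases b <;> simp only [wt, Sum.elim_inr, pm, Bool.false_eq_true, if_true, if_false] <;> fun_prop

/-- The map from the wedge. -/
def Psi (m : ℕ) : C(W m, realization (Tr m)) :=
  ⟨fun p => wn (wt (co p.1.1) (co p.1.2)) (good_W p),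
    wn_cont _ (fun a => wt_cont _ _ (co_cont.comp (continuous_fst.comp continuous_subtype_val))
      (co_cont.comp (continuous_snd.comp continuous_subtype_val)) a) _⟩

/-- The homotopy on the complex: weights. -/
def hX {m : ℕ} (u : ℝ) (f : Fin 3 ⊕ Fin m × Bool → ℝ) : Fin 3 ⊕ Fin m × Bool → ℝ :=
  Sum.elim ![
    max (-((1 - u) * (f (Sum.inl 1) - f (Sum.inl 0)) + u * (1 - 2 * f (Sum.inl 0)))) 0,
    max ((1 - u) * (f (Sum.inl 1) - f (Sum.inl 0)) + u * (1 - 2 * f (Sum.inl 0))) 0 +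
      max ((1 - u) * (f (Sum.inl 1) - f (Sum.inl 2)) + u * (1 - 2 * f (Sum.inl 2))) 0 -
      ((1 - u) * f (Sum.inl 1) + u),
    max (-((1 - u) * (f (Sum.inl 1) - f (Sum.inl 2)) + u * (1 - 2 * f (Sum.inl 2)))) 0]
  (fun p => ((1 - u) + u * (f (Sum.inl 0) + f (Sum.inl 2))) * f (Sum.inr p))

/-- The vector form of the homotopy. -/
def hv {m : ℕ} (u : ℝ) (f : Fin 3 ⊕ Fin m × Bool → ℝ) (j : Fin 3) : Fin (m + 1) → ℝ :=
  Fin.cons ((1 - u) * (f (Sum.inl 1) - f (Sum.inl j)) + u * (1 - 2 * f (Sum.inl j)))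
    (fun i => ((1 - u) + u * f (Sum.inl j)) * (f (Sum.inr (i, true)) - f (Sum.inr (i, false))))

theorem hX_left {m : ℕ} {u : ℝ} (hu0 : 0 ≤ u) (hu1 : u ≤ 1) (f : realization (Tr m))
    (h : f.1 (Sum.inl 2) = 0) : hX u f.1 = wt (hv u f.1 0) (Pi.single 0 1) := by
  have h1 := f.2.1 (Sum.inl 1)
  have h2 := f.2.1 (Sum.inl 0)
  have h3 : 0 ≤ (1 - u) * f.1 (Sum.inl 1) + u := by
    have := mul_nonneg (sub_nonneg.2 hu1) h1
    linarith
  rw [wt_left]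
  funext a
  rcases a with a | a
  · fin_cases a
    · simp [hX, hv]
    · simp [hX, hv, h, max_eq_left h3]
    · simp only [hX, h, Fin.reduceFinMk, Sum.elim_inl, Matrix.cons_val]
      exact max_eq_right (by linarith)
  · simp only [hX, hv, Sum.elim_inr, Fin.cons_succ]
    rw [pm_smul, pm_diff (fun p => f.1 (Sum.inr p)) (fun p => f.2.1 _) (Tr_or f), h, add_zero]
    have := mul_nonneg hu0 h2
    linarith

theorem hX_right {m : ℕ} {u : ℝ} (hu0 : 0 ≤ u) (hu1 : u ≤ 1) (f : realization (Tr m))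
    (h : f.1 (Sum.inl 0) = 0) : hX u f.1 = wt (Pi.single 0 1) (hv u f.1 2) := by
  have h1 := f.2.1 (Sum.inl 1)
  have h2 := f.2.1 (Sum.inl 2)
  have h3 : 0 ≤ (1 - u) * f.1 (Sum.inl 1) + u := by
    have := mul_nonneg (sub_nonneg.2 hu1) h1
    linarith
  rw [wt_right]
  funext a
  rcases a with a | a
  · fin_cases a
    · simp only [hX, h, Fin.zero_eta, Sum.elim_inl, Matrix.cons_val]
      exact max_eq_right (by linarith)
    · simp [hX, hv, h, max_eq_left h3]
    · simp [hX, hv]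
  · simp only [hX, hv, Sum.elim_inr, Fin.cons_succ]
    rw [pm_smul, pm_diff (fun p => f.1 (Sum.inr p)) (fun p => f.2.1 _) (Tr_or f), h, zero_add]
    have := mul_nonneg hu0 h2
    linarith

theorem hv_ne {m : ℕ} {u : ℝ} (hu0 : 0 ≤ u) (hu1 : u ≤ 1) (f : realization (Tr m)) (j : Fin 3)
    (hj1 : j ≠ 1) (hs : f.1 (Sum.inl j) + f.1 (Sum.inl 1) + ∑ p, f.1 (Sum.inr p) = 1) :
    hv u f.1 j ≠ 0 := by
  intro h
  have hj := f.2.1 (Sum.inl j)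
  have h1 : (1 - u) * (f.1 (Sum.inl 1) - f.1 (Sum.inl j)) + u * (1 - 2 * f.1 (Sum.inl j)) = 0 :=
    congrFun h 0
  have h2 : ∀ i, ((1 - u) + u * f.1 (Sum.inl j)) *
      (f.1 (Sum.inr (i, true)) - f.1 (Sum.inr (i, false))) = 0 := fun i => congrFun h i.succ
  by_cases hc : (1 - u) + u * f.1 (Sum.inl j) = 0
  · have hu : u = 1 := by
      have := mul_nonneg hu0 hj
      linarith
    subst hu
    have : f.1 (Sum.inl j) = 0 := by linarith
    rw [this] at h1
    linarith
  · have h3 : ∀ p, f.1 (Sum.inr p) = 0 := by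
      rintro ⟨i, b⟩
      have h4 := (mul_eq_zero.1 (h2 i)).resolve_left hc
      rcases Tr_or f i with h5 | h5 <;> cases b <;> linarith
    simp only [h3, Finset.sum_const_zero, add_zero] at hs
    rcases Tr_or' f j 1 hj1 with h4 | h4
    · rw [h4] at h1 hs
      have : f.1 (Sum.inl 1) = 1 := by linarith
      rw [this] at h1
      linarith
    · rw [h4] at h1 hs
      have : f.1 (Sum.inl j) = 1 := by linarith
      rw [this] at h1
      linarith

theorem good_hX {m : ℕ} {u : ℝ} (hu0 : 0 ≤ u) (hu1 : u ≤ 1) (f : realization (Tr m)) :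
    Good (Tr m) (hX u f.1) := by
  have hs := Tr_sum f
  rcases Tr_or' f 0 2 (by decide) with h | h
  · rw [hX_right hu0 hu1 f h]
    exact good_right _ (hv_ne hu0 hu1 f 2 (by decide) (by linarith))
  · rw [hX_left hu0 hu1 f h]
    exact good_left _ (hv_ne hu0 hu1 f 0 (by decide) (by linarith))

theorem hv_one {m : ℕ} (f : Fin 3 ⊕ Fin m × Bool → ℝ) (j : Fin 3) : hv 1 f j = vA f j := by
  funext i
  refine Fin.cases ?_ (fun i => ?_) i <;> simp [hv, vA]

theorem hX_cont {m : ℕ} {Z : Type*} [TopologicalSpace Z] (u : Z → ℝ) (hu : Continuous u)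
    (f : Z → Fin 3 ⊕ Fin m × Bool → ℝ)
    (hf : ∀ a, Continuous fun z => f z a) (a : Fin 3 ⊕ Fin m × Bool) :
    Continuous fun z => hX (u z) (f z) a := by
  have h0 := hf (Sum.inl 0)
  have h1 := hf (Sum.inl 1)
  have h2 := hf (Sum.inl 2)
  rcases a with a | p
  · fin_cases a <;> simp only [hX, Sum.elim_inl, Fin.zero_eta, Fin.mk_one, Fin.reduceFinMk,
      Matrix.cons_val] <;> fun_prop
  · have h3 := hf (Sum.inr p)
    simp only [hX, Sum.elim_inr]
    fun_prop

theorem max_smul (c t : ℝ) (hc : 0 ≤ c) : max (c * t) 0 = c * max t 0 := by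
  rw [mul_max_of_nonneg _ _ hc, mul_zero]

theorem wt_left_smul {m : ℕ} (x : Fin (m + 1) → ℝ) (c : ℝ) (hc : 0 ≤ c)
    (a : Fin 3 ⊕ Fin m × Bool) :
    wt (c • x) (Pi.single 0 1) a = c * wt x (Pi.single 0 1) a := by
  rw [wt_left, wt_left]
  rcases a with a | a
  · fin_cases a <;> simp [← max_smul _ _ hc]
  · exact pm_smul (fun i => x (Fin.succ i)) c hc a

theorem wt_right_smul {m : ℕ} (x : Fin (m + 1) → ℝ) (c : ℝ) (hc : 0 ≤ c)
    (a : Fin 3 ⊕ Fin m × Bool) :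
    wt (Pi.single 0 1) (c • x) a = c * wt (Pi.single 0 1) x a := by
  rw [wt_right, wt_right]
  rcases a with a | a
  · fin_cases a <;> simp [← max_smul _ _ hc]
  · exact pm_smul (fun i => x (Fin.succ i)) c hc a

theorem hX_zero {m : ℕ} (f : realization (Tr m)) : hX 0 f.1 = f.1 := by
  have h0 := f.2.1 (Sum.inl 0)
  have h1 := f.2.1 (Sum.inl 1)
  have h2 := f.2.1 (Sum.inl 2)
  have h01 := Tr_or' f 0 1 (by decide)
  have h02 := Tr_or' f 0 2 (by decide)
  have h12 := Tr_or' f 1 2 (by decide)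
  funext a
  rcases a with a | a
  · fin_cases a <;> simp only [hX, Sum.elim_inl, Fin.zero_eta, Fin.mk_one, Fin.reduceFinMk,
      Matrix.cons_val, sub_zero, one_mul, zero_mul, add_zero] <;>
    rcases h01 with h01 | h01 <;> rcases h02 with h02 | h02 <;> rcases h12 with h12 | h12 <;>
    simp_all
  · simp [hX]

theorem left_homotopic (m : ℕ) :
    ((Psi m).comp (Phi m)).Homotopic (ContinuousMap.id _) := by
  refine ContinuousMap.Homotopic.symm ⟨⟨⟨fun p => wn (hX p.1 p.2.1)
    (good_hX p.1.2.1 p.1.2.2 p.2), ?_⟩, ?_, ?_⟩⟩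
  · apply wn_cont
    exact fun a => hX_cont _ (by fun_prop) _ (fun b => (real_cont b).comp continuous_snd) a
  · intro f
    change wn (hX 0 f.1) (good_hX le_rfl zero_le_one f) = f
    exact (wn_congr (good_hX le_rfl zero_le_one f) (good_self f) 1 one_pos (by simp [hX_zero])).trans (wn_self f _)
  · intro f
    change wn (hX 1 f.1) (good_hX zero_le_one le_rfl f) = wn (wt (co (nrm (vA f.1 0) (vA_ne f 0)))
      (co (nrm (vA f.1 2) (vA_ne f 2)))) (good_W (Phi m f))
    symm
    have hpt : ∀ j, f.1 (Sum.inl j) = 0 → co (nrm (vA f.1 j) (vA_ne f j)) = Pi.single 0 1 := by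
      intro j hj
      rw [← co_pt]
      congr 1
      refine (nrm_congr _ (co_ne _) 1 one_pos ?_).trans (nrm_co (spherePt m) (co_ne _))
      rw [vA_zero _ _ hj, co_pt, one_smul]
    rcases Tr_or' f 0 2 (by decide) with h | h
    · obtain ⟨c, hc, h3⟩ := co_nrm' _ (vA_ne f 2)
      refine wn_congr _ _ c hc fun a => ?_
      rw [hX_right zero_le_one le_rfl f h, hpt 0 h, h3, hv_one, wt_right_smul _ _ hc.le]
    · obtain ⟨c, hc, h3⟩ := co_nrm' _ (vA_ne f 0)
      refine wn_congr _ _ c hc fun a => ?_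
      rw [hX_left zero_le_one le_rfl f h, hpt 2 h, h3, hv_one, wt_left_smul _ _ hc.le]

/-- The `l1` norm. -/
def T {m : ℕ} (x : Fin (m + 1) → ℝ) : ℝ := ∑ i, |x i|

theorem T_pos {m : ℕ} (x : Fin (m + 1) → ℝ) (hx : x ≠ 0) : 0 < T x := by
  obtain ⟨i, hi⟩ := Function.ne_iff.1 hx
  exact Finset.sum_pos' (fun i _ => abs_nonneg _) ⟨i, Finset.mem_univ _, abs_pos.2 hi⟩

theorem sum_pm {k : ℕ} (v : Fin k → ℝ) : ∑ p, pm v p = ∑ i, |v i| := by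
  rw [Fintype.sum_prod_type]
  refine Finset.sum_congr rfl fun i _ => ?_
  rw [Fintype.sum_bool, pm_add]

theorem max_add_max (t : ℝ) : max (-t) 0 + max t 0 = |t| := by
  rcases le_total t 0 with h | h
  · rw [max_eq_left (by linarith), max_eq_right h, abs_of_nonpos h]; ring
  · rw [max_eq_right (by linarith), max_eq_left h, abs_of_nonneg h]; ring

theorem sum_wt {m : ℕ} (x y : Fin (m + 1) → ℝ) : ∑ a, wt x y a = T x + T y - 1 := by
  rw [Fintype.sum_sum_type, Fin.sum_univ_three]
  simp only [wt, Sum.elim_inl, Sum.elim_inr, Matrix.cons_val]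
  rw [Finset.sum_add_distrib, sum_pm, sum_pm, T, T, Fin.sum_univ_succ, Fin.sum_univ_succ,
    ← max_add_max (x 0), ← max_add_max (y 0)]
  ring

theorem T_pt {m : ℕ} : T (Pi.single 0 1 : Fin (m + 1) → ℝ) = 1 := by
  simp [T, Fin.sum_univ_succ]

/-- The homotopy on the sphere. -/
def hS {m : ℕ} (u : ℝ) (x : Fin (m + 1) → ℝ) : Fin (m + 1) → ℝ :=
  Fin.cons ((1 - u) * x 0 + u * (1 - 2 * (max (-(x 0)) 0 / T x)))
    (fun i => ((1 - u) + u * (max (-(x 0)) 0 / T x / T x)) * x i.succ)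

theorem hS_pt {m : ℕ} (u : ℝ) : hS u (Pi.single 0 1 : Fin (m + 1) → ℝ) = Pi.single 0 1 := by
  funext i
  refine Fin.cases ?_ (fun i => ?_) i
  · simp [hS]
  · simp [hS]

theorem hS_zero {m : ℕ} (x : Fin (m + 1) → ℝ) : hS 0 x = x := by
  funext i
  refine Fin.cases ?_ (fun i => ?_) i <;> simp [hS]

theorem hS_ne {m : ℕ} {u : ℝ} (hu0 : 0 ≤ u) (hu1 : u ≤ 1) (x : Fin (m + 1) → ℝ) (hx : x ≠ 0) :
    hS u x ≠ 0 := by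
  intro h
  have hT := T_pos x hx
  have hm : 0 ≤ max (-(x 0)) 0 := le_max_right _ _
  have h1 : (1 - u) * x 0 + u * (1 - 2 * (max (-(x 0)) 0 / T x)) = 0 := congrFun h 0
  have h2 : ∀ i : Fin m, ((1 - u) + u * (max (-(x 0)) 0 / T x / T x)) * x i.succ = 0 :=
    fun i => congrFun h i.succ
  have hq : 0 ≤ max (-(x 0)) 0 / T x / T x := by positivity
  by_cases hc : (1 - u) + u * (max (-(x 0)) 0 / T x / T x) = 0
  · have hu : u = 1 := by
      have := mul_nonneg hu0 hq
      linarith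
    subst hu
    have h3 : max (-(x 0)) 0 / T x / T x = 0 := by linarith
    have h4 : max (-(x 0)) 0 = 0 := by
      simpa [hT.ne'] using h3
    rw [h4] at h1
    simp at h1
  · have h3 : ∀ i : Fin m, x i.succ = 0 := fun i => (mul_eq_zero.1 (h2 i)).resolve_left hc
    have h4 : T x = |x 0| := by
      rw [T, Fin.sum_univ_succ]
      simp [h3]
    have h5 : x 0 ≠ 0 := by
      intro h6
      rw [h4, h6] at hT
      simp at hT
    rcases lt_or_gt_of_ne h5 with h6 | h6
    · rw [h4, max_eq_left (by linarith), abs_of_neg h6, div_self (by linarith)] at h1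
      have h7 := mul_nonpos_of_nonneg_of_nonpos (sub_nonneg.2 hu1) h6.le
      have h8 : u = 0 := by linarith
      rw [h8] at h1
      linarith
    · rw [max_eq_right (by linarith)] at h1
      simp only [zero_div, mul_zero, sub_zero, mul_one] at h1
      have h7 := mul_nonneg (sub_nonneg.2 hu1) h6.le
      have h8 : u = 0 := by linarith
      rw [h8] at h1
      linarith

theorem hS_cont {m : ℕ} {Z : Type*} [TopologicalSpace Z] (u : Z → ℝ) (hu : Continuous u)
    (x : Z → Fin (m + 1) → ℝ) (hx : Continuous x) (h0 : ∀ z, x z ≠ 0) :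
    Continuous fun z => hS (u z) (x z) := by
  have h1 : ∀ i, Continuous fun z => x z i := fun i => (continuous_apply i).comp hx
  have h10 := h1 0
  have hT : Continuous fun z => T (x z) := by
    unfold T
    exact continuous_finsetSum _ fun i _ => (h1 i).abs
  have hT0 : ∀ z, T (x z) ≠ 0 := fun z => (T_pos _ (h0 z)).ne'
  have hq : Continuous fun z => max (-(x z 0)) 0 / T (x z) :=
    (h10.neg.max continuous_const).div hT hT0
  have hq2 : Continuous fun z => max (-(x z 0)) 0 / T (x z) / T (x z) := hq.div hT hT0
  refine continuous_pi fun i => ?_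
  refine Fin.cases ?_ (fun i => ?_) i
  · simp only [hS, Fin.cons_zero]
    fun_prop
  · have h2 := h1 i.succ
    simp only [hS, Fin.cons_succ]
    fun_prop

theorem hS_one_left {m : ℕ} (x : Fin (m + 1) → ℝ) (hg : Good (Tr m) (wt x (Pi.single 0 1))) :
    vA (wn _ hg).1 0 = hS 1 x := by
  funext i
  have hs : ∑ a, wt x (Pi.single 0 1) a = T x := by rw [sum_wt, T_pt]; ring
  refine Fin.cases ?_ (fun i => ?_) i
  · simp only [vA, hS, Fin.cons_zero, wn_val, hs]
    simp [wt]
  · simp only [vA, hS, Fin.cons_succ, wn_val, hs]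
    rw [← sub_div]
    simp only [wt_left, Sum.elim_inr, Sum.elim_inl, pm_sub, Matrix.cons_val]
    ring

theorem hS_one_right {m : ℕ} (x : Fin (m + 1) → ℝ) (hg : Good (Tr m) (wt (Pi.single 0 1) x)) :
    vA (wn _ hg).1 2 = hS 1 x := by
  funext i
  have hs : ∑ a, wt (Pi.single 0 1) x a = T x := by rw [sum_wt, T_pt]; ring
  refine Fin.cases ?_ (fun i => ?_) i
  · simp only [vA, hS, Fin.cons_zero, wn_val, hs]
    simp [wt]
  · simp only [vA, hS, Fin.cons_succ, wn_val, hs]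
    rw [← sub_div]
    simp only [wt_right, Sum.elim_inr, Sum.elim_inl, pm_sub, Matrix.cons_val]
    ring

theorem hS_one_left' {m : ℕ} (x : Fin (m + 1) → ℝ) (hg : Good (Tr m) (wt x (Pi.single 0 1))) :
    vA (wn _ hg).1 2 = hS 1 (Pi.single 0 1) := by
  rw [hS_pt, vA_zero]
  rw [wn_val, wt_left]
  simp

theorem hS_one_right' {m : ℕ} (x : Fin (m + 1) → ℝ) (hg : Good (Tr m) (wt (Pi.single 0 1) x)) :
    vA (wn _ hg).1 0 = hS 1 (Pi.single 0 1) := by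
  rw [hS_pt, vA_zero]
  rw [wn_val, wt_right]
  simp

theorem hS_one {m : ℕ} (p : W m) : vA (Psi m p).1 0 = hS 1 (co p.1.1) ∧
    vA (Psi m p).1 2 = hS 1 (co p.1.2) := by
  obtain ⟨⟨x, y⟩, h⟩ := p
  have hg := good_W ⟨⟨x, y⟩, h⟩
  change vA (wn (wt (co x) (co y)) hg).1 0 = hS 1 (co x) ∧
    vA (wn (wt (co x) (co y)) hg).1 2 = hS 1 (co y)
  simp only at h hg
  rcases h with h | h
  · have h' : co x = Pi.single 0 1 := by rw [h, co_pt]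
    generalize co x = X at *
    subst h'
    exact ⟨hS_one_right' _ hg, hS_one_right _ hg⟩
  · have h' : co y = Pi.single 0 1 := by rw [h, co_pt]
    generalize co y = X at *
    subst h'
    exact ⟨hS_one_left _ hg, hS_one_left' _ hg⟩

theorem right_homotopic (m : ℕ) :
    ((Phi m).comp (Psi m)).Homotopic (ContinuousMap.id _) := by
  have hpt : ∀ (u : unitInterval) (x : nSphere m), x = spherePt m →
      nrm (hS u (co x)) (hS_ne u.2.1 u.2.2 _ (co_ne x)) = spherePt m := by
    rintro u x rfl
    refine (nrm_congr _ (co_ne _) 1 one_pos ?_).trans (nrm_co (spherePt m) (co_ne _))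
    rw [co_pt, hS_pt, one_smul]
  refine ContinuousMap.Homotopic.symm ⟨⟨⟨fun p =>
    ⟨(nrm (hS p.1 (co p.2.1.1)) (hS_ne p.1.2.1 p.1.2.2 _ (co_ne _)),
      nrm (hS p.1 (co p.2.1.2)) (hS_ne p.1.2.1 p.1.2.2 _ (co_ne _))),
      p.2.2.imp (hpt _ _) (hpt _ _)⟩, ?_⟩, ?_, ?_⟩⟩
  · refine Continuous.subtype_mk (Continuous.prodMk ?_ ?_) _
    · apply nrm_cont
      exact hS_cont _ (by fun_prop) _ (co_cont.comp (continuous_fst.comp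
        (continuous_subtype_val.comp continuous_snd))) (fun _ => co_ne _)
    · apply nrm_cont
      exact hS_cont _ (by fun_prop) _ (co_cont.comp (continuous_snd.comp
        (continuous_subtype_val.comp continuous_snd))) (fun _ => co_ne _)
  · intro p
    apply Subtype.ext
    refine Prod.ext ?_ ?_
    · refine (nrm_congr (hS_ne le_rfl zero_le_one _ (co_ne p.1.1)) (co_ne _) 1 one_pos ?_).trans
        (nrm_co p.1.1 (co_ne _))
      rw [one_smul]
      exact hS_zero _
    · refine (nrm_congr (hS_ne le_rfl zero_le_one _ (co_ne p.1.2)) (co_ne _) 1 one_pos ?_).trans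
        (nrm_co p.1.2 (co_ne _))
      rw [one_smul]
      exact hS_zero _
  · intro p
    apply Subtype.ext
    refine Prod.ext ?_ ?_
    · refine nrm_congr (hS_ne zero_le_one le_rfl _ (co_ne p.1.1)) (vA_ne (Psi m p) 0) 1 one_pos ?_
      rw [one_smul]
      exact (hS_one p).1.symm
    · refine nrm_congr (hS_ne zero_le_one le_rfl _ (co_ne p.1.2)) (vA_ne (Psi m p) 2) 1 one_pos ?_
      rw [one_smul]
      exact (hS_one p).2.symm

theorem tri_wedge (m : ℕ) : Nonempty (ContinuousMap.HomotopyEquiv (realization (Tr m))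
    (WedgeOfSpheres (fun _ : Fin 2 => m))) := by
  obtain ⟨e⟩ := wedge_W m
  exact ⟨ContinuousMap.HomotopyEquiv.trans ⟨Phi m, Psi m, left_homotopic m, right_homotopic m⟩ e⟩


theorem relabel' {α β : Type*} [Fintype α] [Fintype β] (e : β → α) (he : Function.Injective e)
    (K : Set (Finset α)) (L : Set (Finset β)) (h1 : ∀ s ∈ K, ∀ a ∈ s, ∃ b, e b = a)
    (h2 : ∀ t : Finset β, t.map ⟨e, he⟩ ∈ K ↔ t ∈ L) :
    Nonempty (ContinuousMap.HomotopyEquiv (realization K) (realization L)) := by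
  classical
  refine relabel ⟨e, he⟩ K L fun s => ⟨fun hs => ?_, ?_⟩
  · have : s = (Finset.univ.filter fun b => e b ∈ s).map ⟨e, he⟩ := by
      ext a
      simp only [Finset.mem_map, Finset.mem_filter, Finset.mem_univ, true_and,
        Function.Embedding.coeFn_mk]
      constructor
      · intro ha
        obtain ⟨b, rfl⟩ := h1 s hs a ha
        exact ⟨b, ha, rfl⟩
      · rintro ⟨b, hb, rfl⟩
        exact hb
    exact ⟨_, (h2 _).1 (this ▸ hs), this⟩
  · rintro ⟨t, ht, rfl⟩
    exact (h2 t).2 ht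

theorem final1 (k : ℕ) : Nonempty (ContinuousMap.HomotopyEquiv
    (realization (Kc (3 * k + 1) 1)) (realization (Cr k))) := by
  let e : Fin k × Bool → Fin (3 * k + 1) := fun p =>
    ⟨if p.2 then 3 * p.1 + 1 else 3 * p.1 + 2, by split_ifs <;> omega⟩
  have het : ∀ i, (e (i, true) : ℕ) = 3 * i + 1 := fun i => rfl
  have hef : ∀ i, (e (i, false) : ℕ) = 3 * i + 2 := fun i => rfl
  have he : Function.Injective e := by
    rintro ⟨i, b⟩ ⟨j, c⟩ h
    have h := congrArg Fin.val h
    cases b <;> cases c <;> simp only [het, hef] at h <;>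
      first | omega | (congr 1; ext; omega)
  refine relabel' e he _ _ ?_ ?_
  · rintro s ⟨h1, h2, h3, h4⟩ a ha
    have : (a : ℕ) % 3 = 1 ∨ (a : ℕ) % 3 = 2 := by
      by_contra hc
      by_cases h0 : (a : ℕ) = 0
      · exact h2 a ha a ha h0 (by omega)
      · exact h3 a ha (by omega) (by omega)
    rcases this with h | h
    · exact ⟨(⟨a / 3, by omega⟩, true), Fin.ext (by rw [het]; simp only; omega)⟩
    · exact ⟨(⟨a / 3, by omega⟩, false), Fin.ext (by rw [hef]; simp only; omega)⟩
  · intro t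
    constructor
    · rintro ⟨h1, h2, h3, h4⟩ i ⟨hi, hj⟩
      exact h4 (e (i, true)) (Finset.mem_map_of_mem ⟨e, he⟩ hi) (e (i, false))
        (Finset.mem_map_of_mem ⟨e, he⟩ hj) (by rw [het]; omega) (by rw [het, hef])
        (by rw [het]; omega)
    · intro h
      refine ⟨?_, ?_, ?_, ?_⟩
      · intro i hi j hj q1 q2
        omega
      · intro i hi j hj q1 q2
        obtain ⟨⟨i, b⟩, hi', rfl⟩ := Finset.mem_map.1 hi
        cases b <;> simp only [Function.Embedding.coeFn_mk, het, hef] at q1 <;> omega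
      · intro i hi q1 q2
        obtain ⟨⟨i, b⟩, hi', rfl⟩ := Finset.mem_map.1 hi
        cases b <;> simp only [Function.Embedding.coeFn_mk, het, hef] at q1 q2 <;> omega
      · intro i hi j hj q1 q2 q3
        obtain ⟨⟨i, b⟩, hi', rfl⟩ := Finset.mem_map.1 hi
        obtain ⟨⟨j, c⟩, hj', rfl⟩ := Finset.mem_map.1 hj
        cases b <;> cases c <;> simp only [Function.Embedding.coeFn_mk, het, hef] at q1 q2 q3 <;>
          first
          | omega
          | (have hij : i = j := Fin.ext (by omega)
             subst hij
             exact h i ⟨hi', hj'⟩)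

theorem final2 (m : ℕ) : Nonempty (ContinuousMap.HomotopyEquiv
    (realization (Kc (3 * m + 2) 2)) (realization (Cr (m + 1)))) := by
  let e : Fin (m + 1) × Bool → Fin (3 * m + 2) := fun p =>
    ⟨if p.2 then 3 * p.1 - 1 else if (p.1 : ℕ) = 0 then 1 else 3 * p.1, by split_ifs <;> omega⟩
  have het : ∀ i : Fin (m + 1), (e (i, true)).val = 3 * i.val - 1 := fun i => rfl
  have hef : ∀ i : Fin (m + 1), (e (i, false)).val = (if i.val = 0 then 1 else 3 * i.val : ℕ) := fun i => rfl
  have he : Function.Injective e := by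
    rintro ⟨i, b⟩ ⟨j, c⟩ h
    have h := congrArg Fin.val h
    cases b <;> cases c <;> simp only [het, hef] at h <;> (try split_ifs at h) <;>
      first | omega | (congr 1; ext; omega)
  refine relabel' e he _ _ ?_ ?_
  · rintro s ⟨h1, h2, h3, h4⟩ a ha
    have : (a : ℕ) = 0 ∨ (a : ℕ) % 3 = 2 ∨ (a : ℕ) = 1 ∨ ((a : ℕ) % 3 = 0 ∧ (a : ℕ) ≠ 0) := by
      by_contra hc
      exact h3 a ha (by omega) (by omega)
    rcases this with h | h | h | h
    · exact ⟨(0, true), Fin.ext (by rw [het]; simp [h])⟩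
    · exact ⟨(⟨(a + 1) / 3, by omega⟩, true), Fin.ext (by rw [het]; simp only; omega)⟩
    · exact ⟨(0, false), Fin.ext (by rw [hef]; simp [h])⟩
    · exact ⟨(⟨a / 3, by omega⟩, false), Fin.ext (by rw [hef]; simp only; split_ifs <;> omega)⟩
  · intro t
    constructor
    · rintro ⟨h1, h2, h3, h4⟩ i ⟨hi, hj⟩
      by_cases h0 : (i : ℕ) = 0
      · exact h1 (e (i, true)) (Finset.mem_map_of_mem ⟨e, he⟩ hi) (e (i, false))
          (Finset.mem_map_of_mem ⟨e, he⟩ hj) (by rw [het, hef, if_pos h0]; omega)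
          (by rw [hef, if_pos h0]; omega)
      · exact h4 (e (i, true)) (Finset.mem_map_of_mem ⟨e, he⟩ hi) (e (i, false))
          (Finset.mem_map_of_mem ⟨e, he⟩ hj) (by rw [het]; omega)
          (by rw [het, hef, if_neg h0]; omega) (by rw [het]; omega)
    · intro h
      refine ⟨?_, ?_, ?_, ?_⟩
      · intro i hi j hj q1 q2
        obtain ⟨⟨i, b⟩, hi', rfl⟩ := Finset.mem_map.1 hi
        obtain ⟨⟨j, c⟩, hj', rfl⟩ := Finset.mem_map.1 hj
        cases b <;> cases c <;> simp only [Function.Embedding.coeFn_mk, het, hef] at q1 q2 <;>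
          (try split_ifs at q1 q2) <;>
          first
          | omega
          | (have hij : i = j := Fin.ext (by omega)
             subst hij
             exact h i ⟨hi', hj'⟩)
      · intro i hi j hj q1 q2
        obtain ⟨⟨i, b⟩, hi', rfl⟩ := Finset.mem_map.1 hi
        obtain ⟨⟨j, c⟩, hj', rfl⟩ := Finset.mem_map.1 hj
        cases b <;> cases c <;> simp only [Function.Embedding.coeFn_mk, het, hef] at q1 q2 <;>
          (try split_ifs at q1 q2) <;>
          first
          | omega
          | (have hij : i = j := Fin.ext (by omega)
             subst hij
             exact h i ⟨hi', hj'⟩)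
      · intro i hi q1 q2
        obtain ⟨⟨i, b⟩, hi', rfl⟩ := Finset.mem_map.1 hi
        cases b <;> simp only [Function.Embedding.coeFn_mk, het, hef] at q1 q2 <;>
          (try split_ifs at q1 q2) <;> omega
      · intro i hi j hj q1 q2 q3
        obtain ⟨⟨i, b⟩, hi', rfl⟩ := Finset.mem_map.1 hi
        obtain ⟨⟨j, c⟩, hj', rfl⟩ := Finset.mem_map.1 hj
        cases b <;> cases c <;> simp only [Function.Embedding.coeFn_mk, het, hef] at q1 q2 q3 <;>
          (try split_ifs at q1 q2 q3) <;>
          first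
          | omega
          | (have hij : i = j := Fin.ext (by omega)
             subst hij
             exact h i ⟨hi', hj'⟩)

theorem final3 (m : ℕ) : Nonempty (ContinuousMap.HomotopyEquiv
    (realization (Kc (3 * m + 3) 3)) (realization (Tr m))) := by
  let e : Fin 3 ⊕ Fin m × Bool → Fin (3 * m + 3) :=
    Sum.elim (fun i => ⟨i, by omega⟩)
      (fun p => ⟨if p.2 then 3 * p.1 + 3 else 3 * p.1 + 4, by split_ifs <;> omega⟩)
  have hel : ∀ i, (e (Sum.inl i) : ℕ) = i := fun i => rfl
  have het : ∀ i, (e (Sum.inr (i, true)) : ℕ) = 3 * i + 3 := fun i => rfl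
  have hef : ∀ i, (e (Sum.inr (i, false)) : ℕ) = 3 * i + 4 := fun i => rfl
  have he : Function.Injective e := by
    rintro (i | ⟨i, b⟩) (j | ⟨j, c⟩) h
    · exact congrArg Sum.inl (Fin.ext (by simpa [hel] using congrArg Fin.val h))
    · have h := congrArg Fin.val h
      cases c <;> simp only [hel, het, hef] at h <;> omega
    · have h := congrArg Fin.val h
      cases b <;> simp only [hel, het, hef] at h <;> omega
    · have h := congrArg Fin.val h
      cases b <;> cases c <;> simp only [het, hef] at h <;>
        first | omega | (congr 2; ext; omega)
  refine relabel' e he _ _ ?_ ?_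
  · rintro s ⟨h1, h2, h3, h4⟩ a ha
    have : (a : ℕ) < 3 ∨ (3 ≤ (a : ℕ) ∧ (a : ℕ) % 3 = 0) ∨ (3 ≤ (a : ℕ) ∧ (a : ℕ) % 3 = 1) := by
      by_contra hc
      exact h3 a ha (by omega) (by omega)
    rcases this with h | h | h
    · exact ⟨Sum.inl ⟨a, h⟩, rfl⟩
    · exact ⟨Sum.inr (⟨a / 3 - 1, by omega⟩, true), Fin.ext (by rw [het]; simp only; omega)⟩
    · exact ⟨Sum.inr (⟨a / 3 - 1, by omega⟩, false), Fin.ext (by rw [hef]; simp only; omega)⟩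
  · intro t
    constructor
    · rintro ⟨h1, h2, h3, h4⟩
      constructor
      · have key : ∀ i j : Fin 3, Sum.inl i ∈ t → Sum.inl j ∈ t → (i : ℕ) < j → False := by
          intro i j hi hj hij
          have hi := Finset.mem_map_of_mem ⟨e, he⟩ hi
          have hj := Finset.mem_map_of_mem ⟨e, he⟩ hj
          by_cases h5 : (i : ℕ) + 1 = j
          · exact h1 _ hi _ hj h5 j.2
          · exact h2 _ hi _ hj (show (i : ℕ) = 0 by omega) (show (j : ℕ) + 1 = 3 by omega)
        intro i j hi hj
        by_contra hne
        have hne : (i : ℕ) ≠ j := fun h => hne (Fin.ext h)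
        rcases lt_or_gt_of_ne hne with h | h
        · exact key i j hi hj h
        · exact key j i hj hi h
      · rintro i ⟨hi, hj⟩
        exact h4 _ (Finset.mem_map_of_mem ⟨e, he⟩ hi) _ (Finset.mem_map_of_mem ⟨e, he⟩ hj)
          (show 3 ≤ 3 * (i : ℕ) + 3 by omega) (show 3 * (i : ℕ) + 3 + 1 = 3 * (i : ℕ) + 4 by omega)
          (show (3 * (i : ℕ) + 3 - 3) % 3 = 0 by omega)
    · rintro ⟨h0, h⟩
      refine ⟨?_, ?_, ?_, ?_⟩
      · intro i hi j hj q1 q2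
        obtain ⟨i | ⟨i, b⟩, hi', rfl⟩ := Finset.mem_map.1 hi <;>
        obtain ⟨j | ⟨j, c⟩, hj', rfl⟩ := Finset.mem_map.1 hj
        · have := h0 i j hi' hj'
          subst this
          omega
        · cases c <;> simp only [Function.Embedding.coeFn_mk, hel, het, hef] at q1 q2 <;> omega
        · cases b <;> simp only [Function.Embedding.coeFn_mk, hel, het, hef] at q1 q2 <;> omega
        · cases b <;> cases c <;> simp only [Function.Embedding.coeFn_mk, het, hef] at q1 q2 <;>
            omega
      · intro i hi j hj q1 q2
        obtain ⟨i | ⟨i, b⟩, hi', rfl⟩ := Finset.mem_map.1 hi <;>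
        obtain ⟨j | ⟨j, c⟩, hj', rfl⟩ := Finset.mem_map.1 hj
        · have := h0 i j hi' hj'
          subst this
          omega
        · cases c <;> simp only [Function.Embedding.coeFn_mk, hel, het, hef] at q1 q2 <;> omega
        · cases b <;> simp only [Function.Embedding.coeFn_mk, hel, het, hef] at q1 q2 <;> omega
        · cases b <;> cases c <;> simp only [Function.Embedding.coeFn_mk, het, hef] at q1 q2 <;>
            omega
      · intro i hi q1 q2
        obtain ⟨i | ⟨i, b⟩, hi', rfl⟩ := Finset.mem_map.1 hi
        · simp only [Function.Embedding.coeFn_mk, hel] at q1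
          omega
        · cases b <;> simp only [Function.Embedding.coeFn_mk, het, hef] at q1 q2 <;> omega
      · intro i hi j hj q1 q2 q3
        obtain ⟨i | ⟨i, b⟩, hi', rfl⟩ := Finset.mem_map.1 hi
        · simp only [Function.Embedding.coeFn_mk, hel] at q1
          omega
        · obtain ⟨j | ⟨j, c⟩, hj', rfl⟩ := Finset.mem_map.1 hj
          · cases b <;> simp only [Function.Embedding.coeFn_mk, hel, het, hef] at q1 q2 <;> omega
          · cases b <;> cases c <;>
              simp only [Function.Embedding.coeFn_mk, het, hef] at q1 q2 q3 <;>
              first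
              | omega
              | (have hij : i = j := Fin.ext (by omega)
                 subst hij
                 exact h i ⟨hi', hj'⟩)

end MC

/-- The matching complex of the cycle `C_n`: for `n = 3k` it is a wedge of two spheres
`S^(k-1)`; for `n = 3k + 1` (`k ≥ 1`) and `n = 3k - 1` (`k ≥ 2`) it is a single sphere
`S^(k-1)`. -/
theorem matchingComplex_cycleGraph :
    (∀ k : ℕ, 1 ≤ k →
      Nonempty (ContinuousMap.HomotopyEquiv
        (realization (matchingComplex (SimpleGraph.cycleGraph (3 * k))))
        (WedgeOfSpheres (fun _ : Fin 2 => k - 1)))) ∧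
    (∀ k : ℕ, 1 ≤ k →
      Nonempty (ContinuousMap.HomotopyEquiv
        (realization (matchingComplex (SimpleGraph.cycleGraph (3 * k + 1))))
        (nSphere (k - 1)))) ∧
    (∀ k : ℕ, 2 ≤ k →
      Nonempty (ContinuousMap.HomotopyEquiv
        (realization (matchingComplex (SimpleGraph.cycleGraph (3 * k - 1))))
        (nSphere (k - 1)))) := by
  refine ⟨?_, ?_, ?_⟩
  · intro k hk
    obtain ⟨m, rfl⟩ : ∃ m, k = m + 1 := ⟨k - 1, by omega⟩
    obtain ⟨e1⟩ := MC.matching_eq (3 * (m + 1)) (by omega)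
    obtain ⟨e2⟩ := MC.Kc_steps (3 * m + 3) 3 m (by omega) (by omega)
    obtain ⟨e3⟩ := MC.final3 m
    obtain ⟨e4⟩ := MC.tri_wedge m
    rw [show 3 + 3 * m = 3 * m + 3 by omega] at e2
    exact ⟨e1.trans (e2.trans (e3.trans e4))⟩
  · intro k hk
    obtain ⟨m, rfl⟩ : ∃ m, k = m + 1 := ⟨k - 1, by omega⟩
    obtain ⟨e1⟩ := MC.matching_eq (3 * (m + 1) + 1) (by omega)
    obtain ⟨e2⟩ := MC.Kc_steps (3 * (m + 1) + 1) 1 (m + 1) (by omega) (by omega)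
    obtain ⟨e3⟩ := MC.final1 (m + 1)
    obtain ⟨e4⟩ := MC.cross_sphere m
    rw [show 1 + 3 * (m + 1) = 3 * (m + 1) + 1 by omega] at e2
    exact ⟨e1.trans (e2.trans (e3.trans e4))⟩
  · intro k hk
    obtain ⟨m, rfl⟩ : ∃ m, k = m + 1 := ⟨k - 1, by omega⟩
    have hm : 3 * (m + 1) - 1 = 3 * m + 2 := by omega
    rw [hm]
    obtain ⟨e1⟩ := MC.matching_eq (3 * m + 2) (by omega)
    obtain ⟨e2⟩ := MC.Kc_steps (3 * m + 2) 2 m (by omega) (by omega)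
    obtain ⟨e3⟩ := MC.final2 m
    obtain ⟨e4⟩ := MC.cross_sphere m
    rw [show 2 + 3 * m = 3 * m + 2 by omega] at e2
    exact ⟨e1.trans (e2.trans (e3.trans e4))⟩
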